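/- arXiv:1211.2906 — 3 statements merged into one kernel-verified Lean document; each statement's English description precedes it below -/
import Mathlib

section
/- Let d ≥ 2, let ζ' ∈ ℝ^d with first coordinate ζ₁' ≠ 0, and let r > 0 be such that the closed ball B̄(ζ', r) is contained in the open set {ζ ∈ ℝ^d : ζ₁ ≠ 0}. Let φ : ℝ^d → ℝ be C² on an open neighborhood of B̄(ζ', r) and satisfy ζ₁·Δφ(ζ) = 2·∂φ/∂ζ₁(ζ) for every ζ in B̄(ζ', r). Then ∫_{B(ζ',r)} φ(ζ) dζ = v_d·( φ(ζ') + (r²/((d+2)·ζ₁'))·∂φ/∂ζ₁(ζ') ), where v_d denotes the Lebesgue volume of the ball B(ζ', r). -/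
open MeasureTheory

/-- First partial derivative in direction `i` of a scalar function on `ℝ^d`. -/
noncomputable def pd {d : ℕ} (i : Fin d) (f : EuclideanSpace ℝ (Fin d) → ℝ)
    (ζ : EuclideanSpace ℝ (Fin d)) : ℝ :=
  fderiv ℝ f ζ (EuclideanSpace.single i 1)

/-- Laplacian `Δ = Σᵢ ∂²/∂ζᵢ²` of a scalar function on `ℝ^d`. -/
noncomputable def lap {d : ℕ} (f : EuclideanSpace ℝ (Fin d) → ℝ)
    (ζ : EuclideanSpace ℝ (Fin d)) : ℝ :=
  ∑ i : Fin d, pd i (pd i f) ζ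

section MVHelpers
open Set Filter Topology
open scoped ContDiff

variable {d : ℕ}

local notation "E" d => EuclideanSpace ℝ (Fin d)

lemma mv_pd_contDiff {n m : WithTop ℕ∞} {f : (E d) → ℝ} (hf : ContDiff ℝ n f) (hmn : m + 1 ≤ n)
    (i : Fin d) : ContDiff ℝ m (pd i f) :=
  (hf.fderiv_right hmn).clm_apply contDiff_const

lemma mv_pd_cont {f : (E d) → ℝ} (hf : ContDiff ℝ 1 f) (i : Fin d) : Continuous (pd i f) :=
  (mv_pd_contDiff (m := 0) hf (by norm_num) i).continuous

lemma mv_pd_mul {f g : (E d) → ℝ} {x : E d} (hf : DifferentiableAt ℝ f x)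
    (hg : DifferentiableAt ℝ g x) (i : Fin d) :
    pd i (fun y => f y * g y) x = f x * pd i g x + pd i f x * g x := by
  unfold pd
  rw [fderiv_fun_mul hf hg]
  simp [mul_comm]

lemma mv_pd_add {f g : (E d) → ℝ} {x : E d} (hf : DifferentiableAt ℝ f x)
    (hg : DifferentiableAt ℝ g x) (i : Fin d) :
    pd i (fun y => f y + g y) x = pd i f x + pd i g x := by
  unfold pd
  rw [fderiv_fun_add hf hg]
  simp

lemma mv_pd_const_mul {f : (E d) → ℝ} {x : E d} (hf : DifferentiableAt ℝ f x) (c : ℝ)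
    (i : Fin d) : pd i (fun y => c * f y) x = c * pd i f x := by
  unfold pd
  rw [fderiv_const_mul hf]
  simp

lemma mv_pd_zero_off {f : (E d) → ℝ} {r : ℝ}
    (hf : ∀ x, x ∉ Metric.closedBall (0 : E d) r → f x = 0) (i : Fin d) :
    ∀ x, x ∉ Metric.closedBall (0 : E d) r → pd i f x = 0 := by
  intro x hx
  have h : f =ᶠ[𝓝 x] fun _ => 0 := by
    filter_upwards [Metric.isClosed_closedBall.isOpen_compl.mem_nhds hx] with y hy
    exact hf y hy
  unfold pd
  rw [h.fderiv_eq]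
  simp

lemma mv_cs {f : (E d) → ℝ} {r : ℝ}
    (hf : ∀ x, x ∉ Metric.closedBall (0 : E d) r → f x = 0) : HasCompactSupport f :=
  HasCompactSupport.intro (isCompact_closedBall _ _) (fun x hx => hf x hx)

lemma mv_integrable {f g : (E d) → ℝ} {r : ℝ}
    (hf : ∀ x, x ∉ Metric.closedBall (0 : E d) r → f x = 0) (hfc : Continuous f)
    (hgc : Continuous g) : Integrable (fun x => f x * g x) :=
  (hfc.mul hgc).integrable_of_hasCompactSupport (mv_cs hf).mul_right

lemma mv_ibp {f g : (E d) → ℝ} {r : ℝ}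
    (hf : ∀ x, x ∉ Metric.closedBall (0 : E d) r → f x = 0) (hfc : ContDiff ℝ 1 f)
    (hgc : ContDiff ℝ 1 g) (i : Fin d) :
    ∫ x, f x * pd i g x = - ∫ x, pd i f x * g x := by
  apply integral_mul_fderiv_eq_neg_fderiv_mul_of_integrable
  · exact mv_integrable (mv_pd_zero_off hf i) (mv_pd_cont hfc i) hgc.continuous
  · exact mv_integrable hf hfc.continuous (mv_pd_cont hgc i)
  · exact mv_integrable hf hfc.continuous hgc.continuous
  · exact fun x _ => hfc.differentiable (by norm_num) x
  · exact fun x _ => hgc.differentiable (by norm_num) x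

lemma mv_pd_pd {f : (E d) → ℝ} (hf : ContDiff ℝ 2 f) (i j : Fin d) (x : E d) :
    pd i (pd j f) x = fderiv ℝ (fderiv ℝ f) x (EuclideanSpace.single i 1)
      (EuclideanSpace.single j 1) := by
  have h : DifferentiableAt ℝ (fderiv ℝ f) x :=
    (hf.fderiv_right (m := 1) (by norm_num)).differentiable (by norm_num) x
  change fderiv ℝ (fun y => fderiv ℝ f y (EuclideanSpace.single j 1)) x _ = _
  rw [fderiv_clm_apply h (by fun_prop)]
  simp

lemma mv_pd_comm {f : (E d) → ℝ} (hf : ContDiff ℝ 2 f) (i j : Fin d) (x : E d) :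
    pd i (pd j f) x = pd j (pd i f) x := by
  rw [mv_pd_pd hf, mv_pd_pd hf]
  exact (hf.contDiffAt.isSymmSndFDerivAt (by simp)).eq _ _

lemma mv_pd_comp {f : (E d) → ℝ} (hf : Differentiable ℝ f) (c : E d) (s : ℝ) (i : Fin d)
    (x : E d) : pd i (fun y => f (c + s • y)) x = s * pd i f (c + s • x) := by
  have h1 : HasFDerivAt (fun y : E d => c + s • y) (s • ContinuousLinearMap.id ℝ (E d)) x :=
    ((hasFDerivAt_id x).const_smul s).const_add c
  have h2 := (hf (c + s • x)).hasFDerivAt.comp x h1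
  unfold pd
  change fderiv ℝ (f ∘ fun y => c + s • y) x _ = _
  rw [h2.fderiv]
  simp

lemma mv_fderiv_sum {f : (E d) → ℝ} (y x : E d) :
    fderiv ℝ f y x = ∑ i, x i * pd i f y := by
  have : x = ∑ i, x i • EuclideanSpace.single i (1:ℝ) := by
    ext j
    simp [Finset.sum_apply, Pi.single_apply]
  conv_lhs => rw [this]
  simp [pd]

lemma mv_pd_coord (i j : Fin d) (x : E d) :
    pd i (fun y : E d => y j) x = if i = j then 1 else 0 := by
  unfold pd
  have : (fun y : E d => y j) = (EuclideanSpace.proj j : (E d) →L[ℝ] ℝ) := rfl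
  rw [this, ContinuousLinearMap.fderiv]
  simp [eq_comm]

lemma mv_two_le : (2 : WithTop ℕ∞) ≤ ∞ := by
  have : ((2 : ℕ∞) : WithTop ℕ∞) ≤ ∞ := by exact_mod_cast le_top
  exact this

/-- Weak harmonicity. -/
lemma mv_weak {r a b : ℝ} (i0 : Fin d) {R P H : (E d) → ℝ} (hR : ContDiff ℝ ∞ R)
    (hP : ContDiff ℝ 2 P) (hH : ContDiff ℝ ∞ H)
    (hH0 : ∀ x, x ∉ Metric.closedBall (0 : E d) r → H x = 0)
    (hZ : ∀ x ∈ Metric.closedBall (0 : E d) r, (a + b * x i0) * R x = 1)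
    (hpde : ∀ x ∈ Metric.closedBall (0 : E d) r, (a + b * x i0) * lap P x = 2 * b * pd i0 P x) :
    ∑ i, ∫ x, pd i H x * pd i (fun y => R y * pd i0 P y) x = 0 := by
  set w : (E d) → ℝ := fun x => R x * H x with hw
  set Q : (E d) → ℝ := fun y => R y * pd i0 P y with hQ
  set Z : (E d) → ℝ := fun x => a + b * x i0 with hZdef
  have hwc : ContDiff ℝ ∞ w := hR.mul hH
  have hZc : ContDiff ℝ ∞ Z := by fun_prop
  have hw0 : ∀ x, x ∉ Metric.closedBall (0 : E d) r → w x = 0 := by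
    intro x hx; simp [hw, hH0 x hx]
  have hHw : H = fun x => Z x * w x := by
    ext x
    by_cases hx : x ∈ Metric.closedBall (0 : E d) r
    · have := hZ x hx
      simp only [hw, hZdef]; linear_combination (-H x) * this
    · simp [hH0 x hx, hw0 x hx]
  have hPi0 : ContDiff ℝ 1 (pd i0 P) := mv_pd_contDiff hP (by norm_num) i0
  have hQc : ContDiff ℝ 1 Q := (hR.of_le (by exact_mod_cast le_top)).mul hPi0
  have inf1 : (∞ : WithTop ℕ∞) + 1 ≤ ∞ := by simp
  have le1 : (1 : WithTop ℕ∞) ≤ ∞ := by exact_mod_cast le_top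
  have le2 : (2 : WithTop ℕ∞) ≤ ∞ := mv_two_le
  have hne : (∞ : WithTop ℕ∞) ≠ 0 := by simp
  have hHi : ∀ i, ContDiff ℝ ∞ (pd i H) := fun i => mv_pd_contDiff hH inf1 i
  have hwi : ∀ i, ContDiff ℝ ∞ (pd i w) := fun i => mv_pd_contDiff hwc inf1 i
  have hwij : ∀ i j, ContDiff ℝ ∞ (pd i (pd j w)) := fun i j => mv_pd_contDiff (hwi j) inf1 i
  have hwi0 := fun i => mv_pd_zero_off hw0 i
  have hwij0 := fun i j => mv_pd_zero_off (hwi0 j) i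
  have hPi : ∀ i, ContDiff ℝ 1 (pd i P) := fun i => mv_pd_contDiff hP (by norm_num) i
  have hpZ : ∀ i x, pd i Z x = if i = i0 then b else 0 := by
    intro i x
    simp only [hZdef]
    rw [mv_pd_add (by fun_prop) (by fun_prop), mv_pd_const_mul (by fun_prop), mv_pd_coord]
    simp [pd]
  have hpH : ∀ i, pd i H = fun x => Z x * pd i w x + (if i = i0 then b else 0) * w x := by
    intro i
    ext x
    rw [hHw, mv_pd_mul (hZc.differentiable hne x) (hwc.differentiable hne x), hpZ]
  have hppH : ∀ i x, pd i (pd i H) x = Z x * pd i (pd i w) x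
      + 2 * ((if i = i0 then b else 0) * pd i w x) := by
    intro i x
    have d1 : DifferentiableAt ℝ (pd i w) x := (hwi i).differentiable hne x
    have d2 : DifferentiableAt ℝ w x := hwc.differentiable hne x
    have d3 : DifferentiableAt ℝ Z x := hZc.differentiable hne x
    rw [hpH, mv_pd_add (d3.fun_mul d1) (d2.const_mul _), mv_pd_mul d3 d1, mv_pd_const_mul d2, hpZ]
    ring
  -- step 1
  have s1 : ∀ i, ∫ x, pd i H x * pd i Q x = - ∫ x, pd i (pd i H) x * Q x := fun i =>
    mv_ibp (mv_pd_zero_off hH0 i) ((hHi i).of_le le1) hQc i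
  have s2 : ∀ i, ∫ x, pd i (pd i w) x * pd i0 P x = ∫ x, pd i0 (pd i w) x * pd i P x := by
    intro i
    have e1 := mv_ibp (hwij0 i i) ((hwij i i).of_le le1) (hP.of_le (by norm_num)) i0
    have e2 := mv_ibp (hwij0 i0 i) ((hwij i0 i).of_le le1) (hP.of_le (by norm_num)) i
    rw [e1, e2]
    congr 2
    ext x
    rw [mv_pd_comm ((hwi i).of_le le2) i0 i]
  have s3 : ∀ i, ∫ x, pd i0 w x * pd i (pd i P) x = - ∫ x, pd i0 (pd i w) x * pd i P x := by
    intro i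
    rw [mv_ibp (hwi0 i0) ((hwi i0).of_le le1) (hPi i) i]
    congr 2
    ext x
    rw [mv_pd_comm (hwc.of_le le2) i0 i]
  have key : ∀ x, ∑ i, pd i (pd i H) x * Q x =
      ∑ i, (pd i (pd i w) x * pd i0 P x + pd i0 w x * pd i (pd i P) x) := by
    intro x
    by_cases hx : x ∈ Metric.closedBall (0 : E d) r
    · have h1 : Z x * R x = 1 := hZ x hx
      have h2 : Z x * lap P x = 2 * b * pd i0 P x := hpde x hx
      simp only [hppH, Finset.sum_add_distrib, add_mul, ← Finset.mul_sum, ← Finset.sum_mul]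
      have h3 : ∑ i, ((if i = i0 then b else 0) * pd i w x) = b * pd i0 w x := by simp
      have h4 : ∑ i, pd i (pd i P) x = lap P x := rfl
      rw [h3, h4]
      simp only [hQ]
      linear_combination ((∑ i, pd i (pd i w) x) * pd i0 P x + pd i0 w x * lap P x) * h1
        - pd i0 w x * R x * h2
    · simp [hppH, hwij0 _ _ x hx, hwi0 _ x hx]
  have i1 : ∀ i, Integrable (fun x => pd i (pd i H) x * Q x) := fun i =>
    mv_integrable (mv_pd_zero_off (mv_pd_zero_off hH0 i) i)
      (mv_pd_contDiff (hHi i) inf1 i).continuous hQc.continuous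
  have i2 : ∀ i, Integrable (fun x => pd i (pd i w) x * pd i0 P x) := fun i =>
    mv_integrable (hwij0 i i) (hwij i i).continuous hPi0.continuous
  have i3 : ∀ i, Integrable (fun x => pd i0 w x * pd i (pd i P) x) := fun i =>
    mv_integrable (hwi0 i0) (hwi i0).continuous (mv_pd_cont (hPi i) i)
  have i4 : ∀ i, Integrable (fun x => pd i (pd i w) x * pd i0 P x + pd i0 w x * pd i (pd i P) x) :=
    fun i => (i2 i).add (i3 i)
  simp_rw [s1]
  rw [Finset.sum_neg_distrib, ← integral_finsetSum _ (fun i _ => i1 i)]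
  simp_rw [key]
  rw [integral_finsetSum _ (fun i _ => i4 i)]
  simp_rw [fun i => integral_add (i2 i) (i3 i), s2, s3]
  simp

lemma mv_deriv {r : ℝ} {k f : (E d) → ℝ} (hk : Continuous k)
    (hk0 : ∀ x, x ∉ Metric.closedBall (0 : E d) r → k x = 0) (hf : ContDiff ℝ 1 f) (c : E d)
    (s : ℝ) : HasDerivAt (fun s : ℝ => ∫ x, k x * f (c + s • x))
      (∫ x, k x * ∑ i, x i * pd i f (c + s • x)) s := by
  have hfd : Continuous (fderiv ℝ f) := hf.continuous_fderiv (by norm_num)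
  have hF' : Continuous (fun p : ℝ × (E d) => k p.2 * fderiv ℝ f (c + p.1 • p.2) p.2) := by
    have : Continuous (fun p : ℝ × (E d) => fderiv ℝ f (c + p.1 • p.2)) :=
      hfd.comp (by fun_prop)
    exact (hk.comp continuous_snd).mul (this.clm_apply continuous_snd)
  obtain ⟨C, hC⟩ := ((isCompact_closedBall s 1).prod
    (isCompact_closedBall (0 : E d) r)).exists_bound_of_continuousOn hF'.continuousOn
  simp_rw [← mv_fderiv_sum]
  refine (hasDerivAt_integral_of_dominated_loc_of_deriv_le
    (F := fun s x => k x * f (c + s • x))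
    (F' := fun s x => k x * fderiv ℝ f (c + s • x) x)
    (bound := (Metric.closedBall (0 : E d) r).indicator (fun _ => C))
    (s := Metric.ball s 1) (Metric.ball_mem_nhds s one_pos) ?_ ?_ ?_ ?_ ?_ ?_).2
  · refine Eventually.of_forall fun t => Continuous.aestronglyMeasurable ?_
    exact hk.mul (hf.continuous.comp (by fun_prop))
  · exact mv_integrable hk0 hk (hf.continuous.comp (by fun_prop))
  · refine Continuous.aestronglyMeasurable ?_
    exact hF'.comp (by fun_prop : Continuous fun x : E d => (s, x))
  · refine Eventually.of_forall fun x t ht => ?_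
    by_cases hx : x ∈ Metric.closedBall (0 : E d) r
    · rw [indicator_of_mem hx]
      exact hC (t, x) ⟨Metric.ball_subset_closedBall ht, hx⟩
    · rw [indicator_of_notMem hx]
      simp [hk0 x hx]
  · rw [integrable_indicator_iff Metric.isClosed_closedBall.measurableSet]
    exact integrableOn_const (isCompact_closedBall _ _).measure_lt_top.ne
  · refine Eventually.of_forall fun x t _ => ?_
    have h1 : HasDerivAt (fun t : ℝ => c + t • x) x t := by
      simpa using ((hasDerivAt_id t).smul_const x).const_add c
    exact (((hf.differentiable (by norm_num) (c + t • x)).hasFDerivAt).comp_hasDerivAt t h1).const_mul _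

lemma mv_anti {g : ℝ → ℝ} {T : ℝ} (hg : ContDiff ℝ ∞ g) (hg0 : ∀ t, T ≤ t → g t = 0) :
    ∃ G : ℝ → ℝ, ContDiff ℝ ∞ G ∧ (∀ t, T ≤ t → G t = 0) ∧ ∀ t, HasDerivAt G (g t) t := by
  have hd : ∀ t, HasDerivAt (fun t => ∫ u in T..t, g u) (g t) t := fun t =>
    intervalIntegral.integral_hasDerivAt_right (hg.continuous.intervalIntegrable _ _)
      (hg.continuous.stronglyMeasurableAtFilter _ _) hg.continuous.continuousAt
  refine ⟨fun t => ∫ u in T..t, g u, ?_, ?_, hd⟩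
  · rw [contDiff_infty_iff_deriv]
    refine ⟨fun t => (hd t).differentiableAt, ?_⟩
    rw [show deriv (fun t => ∫ u in T..t, g u) = g from funext fun t => (hd t).deriv]
    exact hg
  · intro t ht
    beta_reduce
    rw [intervalIntegral.integral_congr (g := fun _ => 0)]
    · simp
    · intro u hu
      rw [uIcc_of_le ht] at hu
      exact hg0 u hu.1

lemma mv_radial_zero {g : ℝ → ℝ} {r : ℝ} (hr : 0 < r) (hg0 : ∀ t, r ^ 2 ≤ t → g t = 0) :
    ∀ x, x ∉ Metric.closedBall (0 : E d) r → g (‖x‖ ^ 2) = 0 := by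
  intro x hx
  apply hg0
  rw [mem_closedBall_zero_iff, not_le] at hx
  exact pow_le_pow_left₀ hr.le hx.le 2

lemma mv_radial_smooth {g : ℝ → ℝ} (hg : ContDiff ℝ ∞ g) :
    ContDiff ℝ ∞ (fun x : E d => g (‖x‖ ^ 2)) :=
  hg.comp (contDiff_norm_sq ℝ)

lemma mv_radial_pd {g G : ℝ → ℝ} (hG : ∀ t, HasDerivAt G (g t) t) (i : Fin d) (x : E d) :
    pd i (fun x : E d => G (‖x‖ ^ 2)) x = 2 * (g (‖x‖ ^ 2) * x i) := by
  have h1 : HasFDerivAt (fun x : E d => ‖x‖ ^ 2) (2 • (innerSL ℝ x)) x :=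
    (hasStrictFDerivAt_norm_sq x).hasFDerivAt
  have h2 := (hG (‖x‖ ^ 2)).comp_hasFDerivAt x h1
  unfold pd
  change fderiv ℝ (G ∘ fun x : E d => ‖x‖ ^ 2) x _ = _
  rw [h2.fderiv]
  simp [EuclideanSpace.inner_single_right]
  ring

/-- Derivative of radial averages. -/
lemma mv_deriv_radial {r : ℝ} (hr : 0 < r) {g G : ℝ → ℝ} (hg : ContDiff ℝ ∞ g)
    (hg0 : ∀ t, r ^ 2 ≤ t → g t = 0) (hG : ∀ t, HasDerivAt G (g t) t)
    {f : (E d) → ℝ} (hf : ContDiff ℝ 1 f) (c : E d) (s : ℝ) :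
    HasDerivAt (fun s : ℝ => ∫ x : E d, g (‖x‖ ^ 2) * f (c + s • x))
      ((1 / 2) * ∑ i, ∫ x : E d, pd i (fun x : E d => G (‖x‖ ^ 2)) x * pd i f (c + s • x)) s := by
  have hgz := mv_radial_zero (d := d) hr hg0
  have hgc : Continuous (fun x : E d => g (‖x‖ ^ 2)) := (mv_radial_smooth hg).continuous
  convert mv_deriv hgc hgz hf c s using 1
  rw [← integral_finsetSum, ← integral_const_mul]
  · congr 1
    ext x
    simp_rw [mv_radial_pd hG, Finset.mul_sum]
    refine Finset.sum_congr rfl fun i _ => ?_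
    ring
  · intro i _
    simp_rw [mv_radial_pd hG]
    have : Integrable (fun x : E d => g (‖x‖ ^ 2) * (2 * x i * pd i f (c + s • x))) := by
      refine mv_integrable hgz hgc ?_
      have := (mv_pd_cont hf i).comp (by fun_prop : Continuous fun x : E d => c + s • x)
      exact (by fun_prop : Continuous fun x : E d => 2 * x i).mul this
    refine this.congr (Eventually.of_forall fun x => ?_)
    simp only; ring

lemma mv_core {r : ℝ} (hr : 0 < r) (i0 : Fin d) (c : E d) {φ ρ : (E d) → ℝ}
    (hφ : ContDiff ℝ 2 φ) (hρ : ContDiff ℝ ∞ ρ)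
    (hρ1 : ∀ x ∈ Metric.closedBall c r, x i0 * ρ x = 1)
    (hpde : ∀ x ∈ Metric.closedBall c r, x i0 * lap φ x = 2 * pd i0 φ x)
    {g : ℝ → ℝ} (hg : ContDiff ℝ ∞ g) (hg0 : ∀ t, r ^ 2 ≤ t → g t = 0) :
    d * ∫ x : E d, g (‖x‖ ^ 2) * φ (c + x) =
      d * φ c * (∫ x : E d, g (‖x‖ ^ 2))
        + ρ c * pd i0 φ c * ∫ x : E d, g (‖x‖ ^ 2) * ‖x‖ ^ 2 := by
  obtain ⟨G, hG, hG0, hGd⟩ := mv_anti hg hg0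
  obtain ⟨H, hH, hH0, hHd⟩ := mv_anti hG hG0
  have hφi : ∀ i, ContDiff ℝ 1 (pd i φ) := fun i => mv_pd_contDiff hφ (by norm_num) i
  have hφ1 : ContDiff ℝ 1 φ := hφ.of_le (by norm_num)
  set ψ : (E d) → ℝ := fun y => ρ y * pd i0 φ y with hψ
  have hψc : ContDiff ℝ 1 ψ := (hρ.of_le (by exact_mod_cast le_top)).mul (hφi i0)
  have hGz := mv_radial_zero (d := d) hr hG0
  have hHz := mv_radial_zero (d := d) hr hH0
  have hGs := mv_radial_smooth (d := d) hG
  have hHs := mv_radial_smooth (d := d) hH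
  have hin : ∀ s : ℝ, 0 ≤ s → s ≤ 1 → ∀ x ∈ Metric.closedBall (0 : E d) r,
      c + s • x ∈ Metric.closedBall c r := by
    intro s hs0 hs1 x hx
    rw [mem_closedBall_zero_iff] at hx
    rw [mem_closedBall_iff_norm, add_sub_cancel_left, norm_smul, Real.norm_of_nonneg hs0]
    nlinarith [norm_nonneg x]
  -- the average of ψ is constant
  have hN : ∀ s : ℝ, 0 ≤ s → s ≤ 1 → ∫ x : E d, G (‖x‖ ^ 2) * ψ (c + s • x) =
      ψ c * ∫ x : E d, G (‖x‖ ^ 2) := by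
    intro s hs0 hs1
    have h0 : ∫ x : E d, G (‖x‖ ^ 2) * ψ (c + (0 : ℝ) • x) = ψ c * ∫ x : E d, G (‖x‖ ^ 2) := by
      simp only [zero_smul, add_zero, integral_mul_const]
      ring
    rcases hs0.eq_or_lt with rfl | hs
    · exact h0
    have hder := fun t : ℝ => mv_deriv_radial hr hG hG0 hHd hψc c t
    obtain ⟨t, ht, hts⟩ := exists_hasDerivAt_eq_slope _ _ hs
      (fun t _ => (hder t).continuousAt.continuousWithinAt) (fun t _ => hder t)
    have hz : ∑ i, ∫ x : E d, pd i (fun x : E d => H (‖x‖ ^ 2)) x * pd i ψ (c + t • x) = 0 := by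
      have ht1 : t ≤ 1 := ht.2.le.trans hs1
      have hlin : ContDiff ℝ ∞ (fun x : E d => c + t • x) := by fun_prop
      have hpP : ∀ i, pd i (fun x => φ (c + t • x)) = fun x => t * pd i φ (c + t • x) := fun i =>
        funext fun x => mv_pd_comp (hφ.differentiable (by norm_num)) c t i x
      have hw := mv_weak (r := r) (a := c i0) (b := t) i0
        (R := fun x => ρ (c + t • x)) (P := fun x => φ (c + t • x))
        (H := fun x : E d => H (‖x‖ ^ 2)) (hρ.comp hlin) (hφ.comp (hlin.of_le mv_two_le)) hHs hHz
        (by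
          intro x hx
          simpa using hρ1 _ (hin t ht.1.le ht1 x hx))
        (by
          intro x hx
          have := hpde _ (hin t ht.1.le ht1 x hx)
          have hl : lap (fun x => φ (c + t • x)) x = t ^ 2 * lap φ (c + t • x) := by
            unfold lap
            rw [Finset.mul_sum]
            refine Finset.sum_congr rfl fun i _ => ?_
            have dd : DifferentiableAt ℝ (fun x => pd i φ (c + t • x)) x :=
              ((hφi i).comp (hlin.of_le (by exact_mod_cast le_top))).differentiable (by norm_num) x
            rw [hpP, mv_pd_const_mul dd,
              mv_pd_comp ((hφi i).differentiable (by norm_num))]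
            ring
          rw [hl, hpP]
          simp at this
          linear_combination t ^ 2 * this)
      have he : (fun y => ρ (c + t • y) * pd i0 (fun x => φ (c + t • x)) y)
          = fun y => t * ψ (c + t • y) := by
        ext y
        rw [hpP]
        simp only [hψ]
        ring
      rw [he] at hw
      have he2 : ∀ i, pd i (fun y => t * ψ (c + t • y)) = fun x => t ^ 2 * pd i ψ (c + t • x) := by
        intro i
        ext x
        have dd : DifferentiableAt ℝ (fun x => ψ (c + t • x)) x :=
          (hψc.comp (hlin.of_le (by exact_mod_cast le_top))).differentiable (by norm_num) x
        rw [mv_pd_const_mul dd, mv_pd_comp (hψc.differentiable (by norm_num))]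
        ring
      have he3 : ∀ i, ∫ x : E d, pd i (fun x : E d => H (‖x‖ ^ 2)) x *
          pd i (fun y => t * ψ (c + t • y)) x =
          t ^ 2 * ∫ x : E d, pd i (fun x : E d => H (‖x‖ ^ 2)) x * pd i ψ (c + t • x) := by
        intro i
        rw [he2, ← integral_const_mul]
        congr 1
        ext x
        ring
      simp_rw [he3] at hw
      rw [← Finset.mul_sum] at hw
      exact (mul_eq_zero.1 hw).resolve_left (pow_ne_zero _ ht.1.ne')
    rw [hz, mul_zero, h0] at hts
    have := (div_eq_zero_iff.1 hts.symm).resolve_right (by simpa using hs.ne')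
    linarith
  -- the average of φ
  have hM : ∀ s : ℝ, 0 ≤ s → s ≤ 1 →
      (1 / 2) * ∑ i, ∫ x : E d, pd i (fun x : E d => G (‖x‖ ^ 2)) x * pd i φ (c + s • x) =
      - s * (ψ c * ∫ x : E d, G (‖x‖ ^ 2)) := by
    intro s hs0 hs1
    have hlin : ContDiff ℝ 1 (fun x : E d => c + s • x) := by fun_prop
    have e1 : ∀ i, ∫ x : E d, pd i (fun x : E d => G (‖x‖ ^ 2)) x * pd i φ (c + s • x) =
        - ∫ x : E d, G (‖x‖ ^ 2) * (s * pd i (pd i φ) (c + s • x)) := by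
      intro i
      have := mv_ibp hGz (hGs.of_le (by exact_mod_cast le_top)) ((hφi i).comp hlin) i
      simp only [Function.comp_def] at this
      simp_rw [mv_pd_comp ((hφi i).differentiable (by norm_num))] at this
      linarith
    simp_rw [e1]
    rw [Finset.sum_neg_distrib, ← integral_finsetSum, ← hN s hs0 hs1]
    · have : (fun x : E d => ∑ i, G (‖x‖ ^ 2) * (s * pd i (pd i φ) (c + s • x))) =
          fun x => (2 * s) * (G (‖x‖ ^ 2) * ψ (c + s • x)) := by
        ext x
        by_cases hx : x ∈ Metric.closedBall (0 : E d) r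
        · have h1 := hρ1 _ (hin s hs0 hs1 x hx)
          have h2 := hpde _ (hin s hs0 hs1 x hx)
          rw [← Finset.mul_sum, ← Finset.mul_sum]
          change G (‖x‖ ^ 2) * (s * lap φ (c + s • x)) = _
          have h3 : lap φ (c + s • x) = 2 * ψ (c + s • x) := by
            simp only [hψ]
            linear_combination (-lap φ (c + s • x)) * h1 + ρ (c + s • x) * h2
          rw [h3]; ring
        · simp [hGz x hx]
      rw [this, integral_const_mul]
      ring
    · intro i _
      refine mv_integrable hGz hGs.continuous ?_
      exact continuous_const.mul ((mv_pd_cont (hφi i) i).comp hlin.continuous)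
  have hder := fun t : ℝ => mv_deriv_radial hr hg hg0 hGd hφ1 c t
  set K := ψ c * ∫ x : E d, G (‖x‖ ^ 2) with hK
  have hder2 := fun t : ℝ => (hder t).add (((hasDerivAt_id t).pow 2).const_mul (K / 2))
  obtain ⟨t, ht, hts⟩ := exists_hasDerivAt_eq_slope _ _ (zero_lt_one' ℝ)
      (fun t _ => (hder2 t).continuousAt.continuousWithinAt) (fun t _ => hder2 t)
  rw [hM t ht.1.le ht.2.le] at hts
  simp only [Pi.add_apply, Pi.pow_apply, id, one_smul, zero_smul, add_zero, integral_mul_const] at hts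
  have hrel : d * ∫ x : E d, G (‖x‖ ^ 2) = - 2 * ∫ x : E d, g (‖x‖ ^ 2) * ‖x‖ ^ 2 := by
    have e : ∀ i : Fin d, ∫ x : E d, G (‖x‖ ^ 2) = - ∫ x : E d, 2 * (g (‖x‖ ^ 2) * x i) * x i := by
      intro i
      have := mv_ibp hGz (hGs.of_le (by exact_mod_cast le_top))
        (g := fun x : E d => x i) (by fun_prop) i
      simp_rw [mv_radial_pd hGd, mv_pd_coord] at this
      simpa using this
    have e2 : ∑ i : Fin d, ∫ x : E d, G (‖x‖ ^ 2) =
      ∑ i : Fin d, - ∫ x : E d, 2 * (g (‖x‖ ^ 2) * x i) * x i := Finset.sum_congr rfl fun i _ => e i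
    rw [Finset.sum_neg_distrib, ← integral_finsetSum (f := fun i (x : E d) => 2 * (g (‖x‖ ^ 2) * x i) * x i)] at e2
    · simp only [Finset.sum_const, Finset.card_univ, Fintype.card_fin, nsmul_eq_mul] at e2
      rw [e2, neg_mul, ← integral_const_mul]
      congr 2
      ext x
      rw [EuclideanSpace.real_norm_sq_eq, Finset.mul_sum, Finset.mul_sum]
      refine Finset.sum_congr rfl fun i _ => ?_
      ring
    · intro i _
      have : Integrable (fun x : E d => g (‖x‖ ^ 2) * (2 * x i * x i)) :=
        mv_integrable (mv_radial_zero hr hg0) (mv_radial_smooth hg).continuous (by fun_prop)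
      refine this.congr (Eventually.of_forall fun x => ?_)
      simp only; ring
  have hfin : ∫ x : E d, g (‖x‖ ^ 2) * φ (c + x) =
      (∫ x : E d, g (‖x‖ ^ 2)) * φ c - K / 2 := by
    norm_num at hts
    linarith
  rw [hfin, hK]
  linear_combination (-ψ c / 2) * hrel

lemma mv_lim {r : ℝ} (hr : 0 < r) {f : (E d) → ℝ} (hf : Continuous f) :
    Tendsto (fun n : ℕ => ∫ x : E d, Real.smoothTransition (n * (r ^ 2 - ‖x‖ ^ 2)) * f x) atTop
      (𝓝 (∫ x in Metric.ball (0 : E d) r, f x)) := by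
  rw [← integral_indicator Metric.isOpen_ball.measurableSet]
  have hneg : ∀ (n : ℕ) (x : E d), r ≤ ‖x‖ →
      Real.smoothTransition (n * (r ^ 2 - ‖x‖ ^ 2)) = 0 := by
    intro n x hx
    apply Real.smoothTransition.zero_of_nonpos
    have : r ^ 2 ≤ ‖x‖ ^ 2 := pow_le_pow_left₀ hr.le hx 2
    exact mul_nonpos_of_nonneg_of_nonpos (Nat.cast_nonneg n) (by linarith)
  refine tendsto_integral_of_dominated_convergence
    ((Metric.closedBall (0 : E d) r).indicator (fun x => ‖f x‖)) ?_ ?_ ?_ ?_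
  · intro n
    refine Continuous.aestronglyMeasurable ?_
    exact (Real.smoothTransition.continuous.comp (by fun_prop)).mul hf
  · rw [integrable_indicator_iff Metric.isClosed_closedBall.measurableSet]
    exact hf.norm.continuousOn.integrableOn_compact (isCompact_closedBall _ _)
  · intro n
    refine Eventually.of_forall fun x => ?_
    by_cases hx : x ∈ Metric.closedBall (0 : E d) r
    · rw [indicator_of_mem hx, norm_mul, Real.norm_of_nonneg (Real.smoothTransition.nonneg _)]
      exact mul_le_of_le_one_left (norm_nonneg _) (Real.smoothTransition.le_one _)
    · rw [indicator_of_notMem hx]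
      rw [mem_closedBall_zero_iff, not_le] at hx
      simp [hneg n x hx.le]
  · refine Eventually.of_forall fun x => ?_
    by_cases hx : x ∈ Metric.ball (0 : E d) r
    · rw [indicator_of_mem hx]
      rw [mem_ball_zero_iff] at hx
      have hp : 0 < r ^ 2 - ‖x‖ ^ 2 := by
        have := pow_lt_pow_left₀ hx (norm_nonneg x) two_ne_zero
        linarith
      have ht : Tendsto (fun n : ℕ => (n : ℝ) * (r ^ 2 - ‖x‖ ^ 2)) atTop atTop :=
        tendsto_natCast_atTop_atTop.atTop_mul_const hp
      refine tendsto_const_nhds.congr' ?_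
      filter_upwards [ht.eventually_ge_atTop 1] with n hn
      rw [Real.smoothTransition.one_of_one_le hn, one_mul]
    · rw [indicator_of_notMem hx]
      rw [mem_ball_zero_iff, not_lt] at hx
      refine tendsto_const_nhds.congr fun n => ?_
      rw [hneg n x hx, zero_mul]

lemma mv_moment (hd : 2 ≤ d) {r : ℝ} (hr : 0 < r) :
    ∫ x in Metric.ball (0 : E d) r, ‖x‖ ^ 2 =
      d / (d + 2) * r ^ 2 * (volume (Metric.ball (0 : E d) r)).toReal := by
  have : Nontrivial (E d) := by
    have : Nonempty (Fin d) := ⟨⟨0, by omega⟩⟩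
    infer_instance
  have h1 : (Metric.ball (0 : E d) r).indicator (fun x => ‖x‖ ^ 2) =
      fun x => (Iio r).indicator (fun y : ℝ => y ^ 2) ‖x‖ := by
    ext x
    simp [indicator]
  rw [← integral_indicator Metric.isOpen_ball.measurableSet, h1, integral_fun_norm_addHaar,
    Measure.addHaar_ball_of_pos _ _ hr, ENNReal.toReal_mul, ENNReal.toReal_ofReal (by positivity)]
  have h2 : (fun y : ℝ => y ^ (Module.finrank ℝ (E d) - 1) • (Iio r).indicator (fun y : ℝ => y ^ 2) y)
      = (Iio r).indicator (fun y : ℝ => y ^ (d + 1)) := by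
    ext y
    by_cases hy : y < r
    · simp only [indicator, mem_Iio, hy, if_true, finrank_euclideanSpace_fin, smul_eq_mul, ← pow_add]
      congr 1
      omega
    · simp [indicator, hy]
  rw [h2, integral_indicator measurableSet_Iio, Measure.restrict_restrict measurableSet_Iio,
    Iio_inter_Ioi, ← integral_Ioc_eq_integral_Ioo, ← intervalIntegral.integral_of_le hr.le,
    integral_pow]
  simp only [finrank_euclideanSpace_fin, nsmul_eq_mul, smul_eq_mul, Measure.real]
  push_cast
  have : (d : ℝ) + 2 ≠ 0 := by positivity
  have : (d : ℝ) + 1 + 1 ≠ 0 := by positivity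
  field_simp
  ring

lemma mv_global (hd : 2 ≤ d) {r : ℝ} (hr : 0 < r) (i0 : Fin d) (c : E d) {φ ρ : (E d) → ℝ}
    (hφ : ContDiff ℝ 2 φ) (hρ : ContDiff ℝ ∞ ρ)
    (hρ1 : ∀ x ∈ Metric.closedBall c r, x i0 * ρ x = 1)
    (hpde : ∀ x ∈ Metric.closedBall c r, x i0 * lap φ x = 2 * pd i0 φ x) :
    ∫ x in Metric.ball c r, φ x = (volume (Metric.ball c r)).toReal *
      (φ c + r ^ 2 / ((d + 2) * c i0) * pd i0 φ c) := by
  have hcore := fun n : ℕ => mv_core hr i0 c hφ hρ hρ1 hpde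
    (g := fun t => Real.smoothTransition (n * (r ^ 2 - t)))
    (Real.smoothTransition.contDiff.comp (by fun_prop))
    (fun t ht => Real.smoothTransition.zero_of_nonpos
      (mul_nonpos_of_nonneg_of_nonpos (Nat.cast_nonneg n) (by linarith)))
  have l1 := (mv_lim (d := d) hr (f := fun x => φ (c + x))
    (hφ.continuous.comp (by fun_prop))).const_mul (d : ℝ)
  have l2 := (mv_lim (d := d) hr (f := fun x => 1) continuous_const).const_mul (d * φ c)
  have l3 := (mv_lim (d := d) hr (f := fun x => ‖x‖ ^ 2) (by fun_prop)).const_mul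
    (ρ c * pd i0 φ c)
  have hlim := tendsto_nhds_unique l1 ((l2.add l3).congr fun n => by
    simpa using (hcore n).symm)
  rw [mv_moment hd hr] at hlim
  have hc := hρ1 c (Metric.mem_closedBall_self hr.le)
  have hc0 : c i0 ≠ 0 := left_ne_zero_of_mul_eq_one hc
  have hρc : ρ c = 1 / c i0 := by field_simp; linarith
  have hvol : volume (Metric.ball c r) = volume (Metric.ball (0 : E d) r) :=
    Measure.addHaar_ball_center _ _ _
  have htr : ∫ x in Metric.ball c r, φ x = ∫ x in Metric.ball (0 : E d) r, φ (c + x) := by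
    rw [← integral_indicator Metric.isOpen_ball.measurableSet,
      ← integral_indicator Metric.isOpen_ball.measurableSet,
      ← integral_add_left_eq_self _ c]
    congr 1
    ext x
    simp [indicator]
  rw [htr, hvol]
  have hdne : (d : ℝ) ≠ 0 := by
    have : d ≠ 0 := by omega
    exact_mod_cast this
  have hd2 : (d : ℝ) + 2 ≠ 0 := by positivity
  apply mul_left_cancel₀ hdne
  rw [hlim, hρc]
  simp [Measure.real]
  field_simp

lemma mv_congr_near {f h : (E d) → ℝ} {x : E d} (hfh : f =ᶠ[𝓝 x] h) (i : Fin d) :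
    pd i f =ᶠ[𝓝 x] pd i h := by
  filter_upwards [hfh.fderiv (𝕜 := ℝ)] with y hy
  simp [pd, hy]

lemma mv_cutoff_smooth {W : Set (E d)} (hW : IsOpen W) {χ f : (E d) → ℝ} {n : WithTop ℕ∞}
    (hχ : ContDiff ℝ n χ) (hsub : tsupport χ ⊆ W) (hf : ContDiffOn ℝ n f W) :
    ContDiff ℝ n (fun x => χ x * f x) := by
  rw [contDiff_iff_contDiffAt]
  intro x
  by_cases hx : x ∈ W
  · exact hχ.contDiffAt.mul (hf.contDiffAt (hW.mem_nhds hx))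
  · have hx' : x ∉ tsupport χ := fun h => hx (hsub h)
    have : (fun x => χ x * f x) =ᶠ[𝓝 x] fun _ => 0 := by
      filter_upwards [notMem_tsupport_iff_eventuallyEq.1 hx'] with y hy
      simp [hy]
    exact contDiffAt_const.congr_of_eventuallyEq this

end MVHelpers

/-- Mean value identity (volume version) for solutions of `∇·(ζ₁⁻² ∇φ) = 0`,
i.e. `ζ₁·Δφ = 2·∂₁φ`, on a closed ball avoiding `{ζ₁ = 0}`. -/
theorem mean_value_volume (d : ℕ) (hd : 2 ≤ d)
    (ζ' : EuclideanSpace ℝ (Fin d))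
    (hζ'1 : ζ' ⟨0, by omega⟩ ≠ 0)
    (r : ℝ) (hr : 0 < r)
    (hball : Metric.closedBall ζ' r ⊆
      {ζ : EuclideanSpace ℝ (Fin d) | ζ ⟨0, by omega⟩ ≠ 0})
    (φ : EuclideanSpace ℝ (Fin d) → ℝ)
    (V : Set (EuclideanSpace ℝ (Fin d))) (hV : IsOpen V)
    (hVball : Metric.closedBall ζ' r ⊆ V)
    (hφ : ContDiffOn ℝ 2 φ V)
    (hpde : ∀ ζ ∈ Metric.closedBall ζ' r,
      ζ ⟨0, by omega⟩ * lap φ ζ = 2 * pd ⟨0, by omega⟩ φ ζ) :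
    ∫ ζ in Metric.ball ζ' r, φ ζ =
      (volume (Metric.ball ζ' r)).toReal *
        (φ ζ' + r ^ 2 / (((d : ℝ) + 2) * ζ' ⟨0, by omega⟩) * pd ⟨0, by omega⟩ φ ζ') := by
  set i0 : Fin d := ⟨0, by omega⟩ with hi0
  set W : Set (EuclideanSpace ℝ (Fin d)) := V ∩ {ζ | ζ i0 ≠ 0} with hWdef
  have hW : IsOpen W := hV.inter (isOpen_ne_fun (by fun_prop) continuous_const)
  obtain ⟨δ, hδ, hsub⟩ := (isCompact_closedBall ζ' r).exists_cthickening_subset_open hW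
    (Set.subset_inter hVball hball)
  rw [cthickening_closedBall hδ.le hr.le] at hsub
  let χ : ContDiffBump ζ' := ⟨r + δ / 2, δ + r, by positivity, by linarith⟩
  have hts : tsupport χ ⊆ W := by
    rw [χ.tsupport_eq]
    exact hsub
  have hone : ∀ x ∈ Metric.closedBall ζ' r, ∀ᶠ y in nhds x, χ y = 1 := by
    intro x hx
    have hx' : x ∈ Metric.ball ζ' (r + δ / 2) :=
      Metric.closedBall_subset_ball (by linarith) hx
    filter_upwards [Metric.isOpen_ball.mem_nhds hx'] with y hy
    exact χ.one_of_mem_closedBall (Metric.ball_subset_closedBall hy)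
  have hφ2 : ContDiff ℝ 2 (fun x => χ x * φ x) :=
    mv_cutoff_smooth hW (χ.contDiff (n := 2)) hts (hφ.mono Set.inter_subset_left)
  have hρ : ContDiff ℝ (⊤ : ℕ∞) (fun x => χ x * (x i0)⁻¹) := by
    refine mv_cutoff_smooth hW χ.contDiff hts ?_
    refine ContDiffOn.inv (by fun_prop) ?_
    exact fun x hx => hx.2
  have heq : ∀ x ∈ Metric.closedBall ζ' r, (fun x => χ x * φ x) =ᶠ[nhds x] φ := by
    intro x hx
    filter_upwards [hone x hx] with y hy
    simp [hy]
  have hmain := mv_global hd hr i0 ζ' hφ2 hρ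
    (by
      intro x hx
      have h1 := (hone x hx).self_of_nhds
      have h2 : x i0 ≠ 0 := hball hx
      simp only [h1]
      field_simp)
    (by
      intro x hx
      have h1 := heq x hx
      have h2 : lap (fun x => χ x * φ x) x = lap φ x := by
        unfold lap
        exact Finset.sum_congr rfl fun i _ =>
          (mv_congr_near (mv_congr_near h1 i) i).self_of_nhds
      rw [h2, (mv_congr_near h1 i0).self_of_nhds]
      exact hpde x hx)
  have hcm : ζ' ∈ Metric.closedBall ζ' r := Metric.mem_closedBall_self hr.le
  rw [(mv_congr_near (heq ζ' hcm) i0).self_of_nhds, (hone ζ' hcm).self_of_nhds, one_mul] at hmain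
  rw [← hmain]
  refine setIntegral_congr_fun Metric.isOpen_ball.measurableSet fun x hx => ?_
  exact ((heq x (Metric.ball_subset_closedBall hx)).self_of_nhds).symm
end

section
/- Let d ≥ 2, let ζ' ∈ ℝ^d with first coordinate ζ₁' ≠ 0, and let r > 0 be such that the closed ball B̄(ζ', r) is contained in the open set {ζ ∈ ℝ^d : ζ₁ ≠ 0}. Let φ : ℝ^d → ℝ be C² on an open neighborhood of B̄(ζ', r) and satisfy ζ₁·Δφ(ζ) = 2·∂φ/∂ζ₁(ζ) for every ζ in B̄(ζ', r). Then the surface integral of φ over the sphere ∂B(ζ', r) (with respect to the (d−1)-dimensional Hausdorff measure) equals s_{d−1}·( φ(ζ') + (r²/(d·ζ₁'))·∂φ/∂ζ₁(ζ') ), where s_{d−1} denotes the (d−1)-dimensional Hausdorff measure (surface area) of the sphere ∂B(ζ', r). -/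
open MeasureTheory

open Metric Set Filter Topology

lemma int_of_cont {E : Type*} [NormedAddCommGroup E] [MeasurableSpace E] [BorelSpace E]
    {μ : Measure E} [IsFiniteMeasure μ] {K : Set E} (hKc : IsCompact K)
    (hK : ∀ᵐ y ∂μ, y ∈ K) {f : E → ℝ} (hf : ContinuousOn f K) : Integrable f μ := by
  rw [← Measure.restrict_eq_self_of_ae_mem hK]
  exact hf.integrableOn_compact hKc

lemma diff_int {E : Type*} [NormedAddCommGroup E] [MeasurableSpace E] [BorelSpace E]
    {μ : Measure E} [IsFiniteMeasure μ] {K : Set E} (hKc : IsCompact K)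
    (hK : ∀ᵐ y ∂μ, y ∈ K) {I : Set ℝ} (hI : IsOpen I) (f f' : ℝ → E → ℝ)
    (hf : ∀ t ∈ I, ∀ y ∈ K, HasDerivAt (fun s => f s y) (f' t y) t)
    (hfc : ∀ t ∈ I, ContinuousOn (f t) K)
    (hfc' : ContinuousOn (fun p : ℝ × E => f' p.1 p.2) (I ×ˢ K)) {t : ℝ} (ht : t ∈ I) :
    HasDerivAt (fun s => ∫ y, f s y ∂μ) (∫ y, f' t y ∂μ) t := by
  obtain ⟨ε, hε, hεI⟩ := Metric.nhds_basis_closedBall.mem_iff.1 (hI.mem_nhds ht)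
  have hcomp : IsCompact (closedBall t ε ×ˢ K) := (isCompact_closedBall t ε).prod hKc
  obtain ⟨C, hC⟩ := hcomp.exists_bound_of_continuousOn
    (hfc'.mono (prod_mono hεI subset_rfl))
  have hc' : ContinuousOn (f' t) K := by
    have : ContinuousOn (fun y : E => ((t, y) : ℝ × E)) K := by fun_prop
    exact hfc'.comp this (fun y hy => ⟨ht, hy⟩)
  refine (hasDerivAt_integral_of_dominated_loc_of_deriv_le (bound := fun _ => C)
    (ball_mem_nhds t hε) ?_ (int_of_cont hKc hK (hfc t ht))
    (int_of_cont hKc hK hc').aestronglyMeasurable ?_ (integrable_const C) ?_).2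
  · filter_upwards [hI.mem_nhds ht] with s hs
    exact (int_of_cont hKc hK (hfc s hs)).aestronglyMeasurable
  · filter_upwards [hK] with y hy s hs
    exact hC (s, y) ⟨ball_subset_closedBall hs, hy⟩
  · filter_upwards [hK] with y hy s hs
    exact hf s (hεI (ball_subset_closedBall hs)) y hy

lemma rot_int {E : Type*} [NormedAddCommGroup E] [InnerProductSpace ℝ E] [FiniteDimensional ℝ E]
    [MeasurableSpace E] [BorelSpace E]
    {μ : Measure E} [IsFiniteMeasure μ] {r : ℝ}
    (hK : ∀ᵐ y ∂μ, y ∈ sphere (0 : E) r)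
    (hinv : ∀ e : E ≃ₗᵢ[ℝ] E, MeasurePreserving e μ μ)
    (A : E →L[ℝ] E) (hA : ∀ x y, inner ℝ (A x) y = - inner ℝ x (A y))
    (g : E → ℝ) (g' : E → E →L[ℝ] ℝ)
    (hg : ∀ y ∈ sphere (0 : E) r, HasFDerivAt g (g' y) y)
    (hg' : ContinuousOn g' (sphere (0 : E) r)) :
    ∫ y, g' y (A y) ∂μ = 0 := by
  let _ : NormedAlgebra ℚ (E →L[ℝ] E) := NormedAlgebra.restrictScalars ℚ ℝ _
  have hsk : ∀ t : ℝ, t • A ∈ skewAdjoint (E →L[ℝ] E) := by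
    intro t
    rw [skewAdjoint.mem_iff, ContinuousLinearMap.star_eq_adjoint, eq_comm,
      ContinuousLinearMap.eq_adjoint_iff]
    intro x y
    simp [inner_smul_left, inner_smul_right, hA]
  let R : ℝ → E →L[ℝ] E := fun t => NormedSpace.exp (t • A)
  let e : ℝ → E ≃ₗᵢ[ℝ] E := fun t => Unitary.linearIsometryEquiv
    ⟨NormedSpace.exp (t • A), NormedSpace.exp_mem_unitary_of_mem_skewAdjoint (hsk t)⟩
  have he : ∀ t y, e t y = R t y := fun t y => rfl
  have hR : ∀ t, HasDerivAt R (A * R t) t := fun t => hasDerivAt_exp_smul_const' A t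
  have hRc : Continuous R := continuous_iff_continuousAt.2 fun t => (hR t).continuousAt
  have hRs : ∀ t, ∀ y ∈ sphere (0 : E) r, R t y ∈ sphere (0 : E) r := by
    intro t y hy
    rw [← he]
    simpa using hy
  have hgc : ContinuousOn g (sphere (0 : E) r) := fun y hy =>
    (hg y hy).continuousAt.continuousWithinAt
  have key := diff_int (μ := μ) (isCompact_sphere (0 : E) r) hK isOpen_univ
    (fun t y => g (R t y)) (fun t y => g' (R t y) (A (R t y))) ?_ ?_ ?_ (mem_univ (0 : ℝ))
  · have hconst : (fun s => ∫ y, g (R s y) ∂μ) = fun _ => ∫ y, g y ∂μ := by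
      funext s
      exact (hinv (e s)).integral_comp (e s).toHomeomorph.measurableEmbedding g
    rw [hconst] at key
    have := key.unique (hasDerivAt_const _ _)
    simpa [R] using this
  · intro t _ y hy
    have h1 : HasDerivAt (fun s => R s y) ((A * R t) y) t :=
      (hR t).clm_apply (hasDerivAt_const t y) |>.congr_deriv (by simp)
    exact (hg _ (hRs t y hy)).comp_hasDerivAt t h1
  · intro t _
    exact hgc.comp (R t).continuous.continuousOn (hRs t)
  · have h2 : ContinuousOn (fun p : ℝ × E => R p.1 p.2) (univ ×ˢ sphere (0 : E) r) := by
      fun_prop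
    have h3 : ContinuousOn (fun p : ℝ × E => g' (R p.1 p.2)) (univ ×ˢ sphere (0 : E) r) :=
      hg'.comp h2 (fun p hp => hRs _ _ hp.2)
    exact h3.clm_apply (A.continuous.comp_continuousOn h2)

lemma rot_int_coord {d : ℕ} {μ : Measure (EuclideanSpace ℝ (Fin d))} [IsFiniteMeasure μ] {r : ℝ}
    (hK : ∀ᵐ y ∂μ, y ∈ sphere (0 : EuclideanSpace ℝ (Fin d)) r)
    (hinv : ∀ e : EuclideanSpace ℝ (Fin d) ≃ₗᵢ[ℝ] EuclideanSpace ℝ (Fin d),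
      MeasurePreserving e μ μ)
    (g : EuclideanSpace ℝ (Fin d) → ℝ)
    (g' : EuclideanSpace ℝ (Fin d) → EuclideanSpace ℝ (Fin d) →L[ℝ] ℝ)
    (hg : ∀ y ∈ sphere (0 : EuclideanSpace ℝ (Fin d)) r, HasFDerivAt g (g' y) y)
    (hg' : ContinuousOn g' (sphere (0 : EuclideanSpace ℝ (Fin d)) r)) (i j : Fin d) :
    ∫ y, (y i * g' y (EuclideanSpace.single j 1) - y j * g' y (EuclideanSpace.single i 1)) ∂μ
      = 0 := by
  let A : EuclideanSpace ℝ (Fin d) →L[ℝ] EuclideanSpace ℝ (Fin d) :=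
    (EuclideanSpace.proj i : EuclideanSpace ℝ (Fin d) →L[ℝ] ℝ).smulRight
        (EuclideanSpace.single j (1 : ℝ)) -
      (EuclideanSpace.proj j : EuclideanSpace ℝ (Fin d) →L[ℝ] ℝ).smulRight
        (EuclideanSpace.single i (1 : ℝ))
  have hAy : ∀ y, A y = y i • EuclideanSpace.single j (1 : ℝ)
      - y j • EuclideanSpace.single i (1 : ℝ) := fun y => by simp [A]
  have := rot_int hK hinv A ?_ g g' hg hg'
  · simpa [hAy] using this
  · intro x y
    simp only [hAy, inner_sub_left, inner_sub_right, inner_smul_left, inner_smul_right,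
      EuclideanSpace.inner_single_left, EuclideanSpace.inner_single_right]
    simp
    ring

lemma clm_coord {d : ℕ} (L : EuclideanSpace ℝ (Fin d) →L[ℝ] ℝ) (y : EuclideanSpace ℝ (Fin d)) :
    L y = ∑ i, y i * L (EuclideanSpace.single i 1) := by
  conv_lhs => rw [← (EuclideanSpace.basisFun (Fin d) ℝ).sum_repr y]
  simp [map_sum]

/-- the ODE -/
lemma ode_sol {d : ℕ} (hd : 2 ≤ d) (H H' : ℝ → ℝ) (c : ℝ)
    (hH : ∀ t ∈ Ico (0 : ℝ) 1, HasDerivAt H (H' t) t)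
    (hode : ∀ t ∈ Ico (0 : ℝ) 1, t * H' t + ((d : ℝ) - 1) * H t = c * t) :
    ∀ t ∈ Ioo (0 : ℝ) 1, H t = c * t / d := by
  intro t ht
  obtain ⟨n, rfl⟩ : ∃ n, d = n + 2 := ⟨d - 2, by omega⟩
  have hn : ((n + 2 : ℕ) : ℝ) ≠ 0 := by positivity
  let f : ℝ → ℝ := fun s => s ^ (n + 1) * H s - c * s ^ (n + 2) / ((n + 2 : ℕ) : ℝ)
  have hf : ∀ s ∈ Ico (0 : ℝ) 1, HasDerivAt f 0 s := by
    intro s hs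
    have h1 := ((hasDerivAt_pow (n + 1) s).mul (hH s hs)).sub
      (((hasDerivAt_pow (n + 2) s).const_mul c).div_const ((n + 2 : ℕ) : ℝ))
    refine h1.congr_deriv ?_
    have := hode s hs
    have e : c * (((n + 2 : ℕ) : ℝ) * s ^ (n + 2 - 1)) / ((n + 2 : ℕ) : ℝ) = c * s ^ (n + 1) := by
      field_simp
      simp
    rw [e]
    push_cast at this ⊢
    linear_combination s ^ n * this
  have hfc := constant_of_has_deriv_right_zero (f := f) (a := 0) (b := t)
    (fun s hs => (hf s ⟨hs.1, hs.2.trans_lt ht.2⟩).continuousAt.continuousWithinAt)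
    (fun s hs => (hf s ⟨hs.1, hs.2.trans ht.2⟩).hasDerivWithinAt) t ⟨ht.1.le, le_rfl⟩
  simp only [f] at hfc
  have ht0 : t ^ (n + 1) ≠ 0 := pow_ne_zero _ ht.1.ne'
  apply mul_left_cancel₀ ht0
  simp at hfc
  push_cast
  linear_combination hfc

lemma div_id {d : ℕ} {μ : Measure (EuclideanSpace ℝ (Fin d))} [IsFiniteMeasure μ] {r : ℝ}
    (hK : ∀ᵐ y ∂μ, y ∈ sphere (0 : EuclideanSpace ℝ (Fin d)) r)
    (hinv : ∀ e : EuclideanSpace ℝ (Fin d) ≃ₗᵢ[ℝ] EuclideanSpace ℝ (Fin d),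
      MeasurePreserving e μ μ)
    {U : Set (EuclideanSpace ℝ (Fin d))} (z : EuclideanSpace ℝ (Fin d))
    (F : Fin d → EuclideanSpace ℝ (Fin d) → ℝ)
    (F' : Fin d → EuclideanSpace ℝ (Fin d) → EuclideanSpace ℝ (Fin d) →L[ℝ] ℝ)
    (hF : ∀ j, ∀ x ∈ U, HasFDerivAt (F j) (F' j x) x)
    (hF' : ∀ j, ContinuousOn (F' j) U) (t : ℝ)
    (htU : ∀ y ∈ sphere (0 : EuclideanSpace ℝ (Fin d)) r, z + t • y ∈ U) :
    t * ∫ y, ∑ j, y j * F' j (z + t • y) y ∂μ + ((d : ℝ) - 1) * ∫ y, ∑ j, y j * F j (z + t • y) ∂μ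
      = r ^ 2 * t * ∫ y, ∑ j, F' j (z + t • y) (EuclideanSpace.single j 1) ∂μ := by
  have hKc := isCompact_sphere (0 : EuclideanSpace ℝ (Fin d)) r
  have hz : ContinuousOn (fun y : EuclideanSpace ℝ (Fin d) => z + t • y) (sphere 0 r) := by
    fun_prop
  have hFc : ∀ j, ContinuousOn (fun y => F j (z + t • y)) (sphere 0 r) := fun j =>
    ContinuousOn.comp (fun x hx => (hF j x hx).continuousAt.continuousWithinAt) hz htU
  have hFc' : ∀ j, ContinuousOn (fun y => F' j (z + t • y)) (sphere 0 r) := fun j =>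
    (hF' j).comp hz htU
  have hyc : ∀ j, ContinuousOn (fun y : EuclideanSpace ℝ (Fin d) => y j) (sphere 0 r) := by
    intro j; fun_prop
  let G : Fin d → Fin d → EuclideanSpace ℝ (Fin d) → EuclideanSpace ℝ (Fin d) →L[ℝ] ℝ :=
    fun i j y => y i • (t • F' j (z + t • y)) +
      F j (z + t • y) • (EuclideanSpace.proj i : EuclideanSpace ℝ (Fin d) →L[ℝ] ℝ)
  have hGc : ∀ i j, ContinuousOn (G i j) (sphere 0 r) := by
    intro i j
    exact ((hyc i).smul ((hFc' j).const_smul t)).add ((hFc j).smul continuousOn_const)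
  have hG : ∀ i j, ∀ y ∈ sphere (0 : EuclideanSpace ℝ (Fin d)) r,
      HasFDerivAt (fun y => y i * F j (z + t • y)) (G i j y) y := by
    intro i j y hy
    have h1 : HasFDerivAt (fun y : EuclideanSpace ℝ (Fin d) => y i)
      (EuclideanSpace.proj i : EuclideanSpace ℝ (Fin d) →L[ℝ] ℝ) y :=
      (EuclideanSpace.proj i : EuclideanSpace ℝ (Fin d) →L[ℝ] ℝ).hasFDerivAt
    have h2 : HasFDerivAt (fun y : EuclideanSpace ℝ (Fin d) => z + t • y)
      (t • ContinuousLinearMap.id ℝ _) y := ((hasFDerivAt_id y).const_smul t).const_add z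
    have h3 := h1.mul ((hF j _ (htU y hy)).comp y h2)
    refine h3.congr_fderiv ?_
    ext v
    simp [G]
  have hGi : ∀ i j k l, Integrable (fun y => y k * G i j y (EuclideanSpace.single l 1)) μ :=
    fun i j k l => int_of_cont hKc hK ((hyc k).mul ((hGc i j).clm_apply continuousOn_const))
  have h0 : ∫ y, ∑ i, ∑ j, (y i * G i j y (EuclideanSpace.single j 1)
      - y j * G i j y (EuclideanSpace.single i 1)) ∂μ = 0 := by
    have hs : ∀ i j, Integrable (fun y => y i * G i j y (EuclideanSpace.single j 1)
      - y j * G i j y (EuclideanSpace.single i 1)) μ := fun i j => (hGi i j i j).sub (hGi i j j i)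
    rw [integral_finsetSum _ fun i _ => integrable_finsetSum _ fun j _ => hs i j]
    refine Finset.sum_eq_zero fun i _ => ?_
    rw [integral_finsetSum _ fun j _ => hs i j]
    exact Finset.sum_eq_zero fun j _ => rot_int_coord hK hinv _ _ (hG i j) (hGc i j) i j
  have i1 : Integrable (fun y => ∑ j, y j * F' j (z + t • y) y) μ :=
    int_of_cont hKc hK (continuousOn_finsetSum _ fun j _ =>
      (hyc j).mul ((hFc' j).clm_apply continuousOn_id))
  have i2 : Integrable (fun y => ∑ j, y j * F j (z + t • y)) μ :=
    int_of_cont hKc hK (continuousOn_finsetSum _ fun j _ => (hyc j).mul (hFc j))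
  have i3 : Integrable (fun y => ∑ j, F' j (z + t • y) (EuclideanSpace.single j 1)) μ :=
    int_of_cont hKc hK (continuousOn_finsetSum _ fun j _ =>
      (hFc' j).clm_apply continuousOn_const)
  have h1 : ∫ y, (r ^ 2 * t * ∑ j, F' j (z + t • y) (EuclideanSpace.single j 1)
      - (t * (∑ j, y j * F' j (z + t • y) y) + ((d : ℝ) - 1) * ∑ j, y j * F j (z + t • y))) ∂μ
      = 0 := by
    rw [← h0]
    refine integral_congr_ae ?_
    filter_upwards [hK] with y hy
    have hr2 : ∑ i, y i * y i = r ^ 2 := by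
      have : ‖y‖ = r := by simpa using hy
      rw [← this, EuclideanSpace.real_norm_sq_eq]
      simp [sq]
    have e1 : ∀ j, F' j (z + t • y) y = ∑ i, y i * F' j (z + t • y) (EuclideanSpace.single i 1) :=
      fun j => clm_coord _ _
    have e2 : ∀ i j, (y i * G i j y (EuclideanSpace.single j 1)
      - y j * G i j y (EuclideanSpace.single i 1)) =
      t * ((y i * y i) * F' j (z + t • y) (EuclideanSpace.single j 1))
        + (if i = j then y i * F j (z + t • y) else 0)
        - t * (y j * (y i * F' j (z + t • y) (EuclideanSpace.single i 1)))
        - y j * F j (z + t • y) := by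
      intro i j
      simp only [G]
      by_cases h : i = j
      · subst h; simp; ring
      · simp [h]; ring
    simp only [e2, Finset.sum_sub_distrib, Finset.sum_add_distrib, e1]
    simp only [← Finset.mul_sum]
    rw [← hr2]
    have e3 : ∑ i, ∑ j, (y i * y i) * F' j (z + t • y) (EuclideanSpace.single j 1)
      = (∑ i, y i * y i) * ∑ j, F' j (z + t • y) (EuclideanSpace.single j 1) := by
      rw [Finset.sum_mul_sum]
    simp only [← Finset.mul_sum] at e3
    have e4 : ∑ i, ∑ j, y j * (y i * F' j (z + t • y) (EuclideanSpace.single i 1))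
      = ∑ j, y j * ∑ i, (y i * F' j (z + t • y) (EuclideanSpace.single i 1)) := by
      rw [Finset.sum_comm]
      simp only [← Finset.mul_sum]
    rw [e3, e4]
    simp
    ring
  have i12 : Integrable (fun y => t * (∑ j, y j * F' j (z + t • y) y) +
      ((d : ℝ) - 1) * ∑ j, y j * F j (z + t • y)) μ := (i1.const_mul _).add (i2.const_mul _)
  rw [integral_sub (i3.const_mul _) i12,
    integral_add (i1.const_mul _) (i2.const_mul _)] at h1
  simp only [integral_const_mul] at h1
  linarith

/-- derivative of spherical means -/
lemma mean_deriv {d : ℕ} {μ : Measure (EuclideanSpace ℝ (Fin d))} [IsFiniteMeasure μ] {r : ℝ}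
    (hK : ∀ᵐ y ∂μ, y ∈ sphere (0 : EuclideanSpace ℝ (Fin d)) r)
    {U : Set (EuclideanSpace ℝ (Fin d))} (z : EuclideanSpace ℝ (Fin d))
    {I : Set ℝ} (hI : IsOpen I)
    (hIU : ∀ t ∈ I, ∀ y ∈ sphere (0 : EuclideanSpace ℝ (Fin d)) r, z + t • y ∈ U)
    {ι : Type*} [Fintype ι] (a : ι → EuclideanSpace ℝ (Fin d) → ℝ) (ha : ∀ j, Continuous (a j))
    (F : ι → EuclideanSpace ℝ (Fin d) → ℝ)
    (F' : ι → EuclideanSpace ℝ (Fin d) → EuclideanSpace ℝ (Fin d) →L[ℝ] ℝ)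
    (hF : ∀ j, ∀ x ∈ U, HasFDerivAt (F j) (F' j x) x)
    (hF' : ∀ j, ContinuousOn (F' j) U) (t : ℝ) (ht : t ∈ I) :
    HasDerivAt (fun t => ∫ y, ∑ j, a j y * F j (z + t • y) ∂μ)
      (∫ y, ∑ j, a j y * F' j (z + t • y) y ∂μ) t := by
  have hKc := isCompact_sphere (0 : EuclideanSpace ℝ (Fin d)) r
  refine diff_int hKc hK hI (fun t y => ∑ j, a j y * F j (z + t • y))
    (fun t y => ∑ j, a j y * F' j (z + t • y) y) ?_ ?_ ?_ ht
  · intro s hs y hy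
    refine HasDerivAt.fun_sum fun j _ => HasDerivAt.const_mul _ ?_
    have h2 : HasDerivAt (fun s : ℝ => z + s • y) y s :=
      (((hasDerivAt_id s).smul_const y).const_add z).congr_deriv (by simp)
    exact (hF j _ (hIU s hs y hy)).comp_hasDerivAt s h2
  · intro s hs
    have hz : ContinuousOn (fun y : EuclideanSpace ℝ (Fin d) => z + s • y) (sphere 0 r) := by
      fun_prop
    exact continuousOn_finsetSum _ fun j _ => (ha j).continuousOn.mul
      (ContinuousOn.comp (fun x hx => (hF j x hx).continuousAt.continuousWithinAt) hz (hIU s hs))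
  · have hz : ContinuousOn (fun p : ℝ × EuclideanSpace ℝ (Fin d) => z + p.1 • p.2)
      (I ×ˢ sphere 0 r) := by fun_prop
    refine continuousOn_finsetSum _ fun j _ => ContinuousOn.mul
      ((ha j).comp continuous_snd).continuousOn (ContinuousOn.clm_apply ?_ continuousOn_snd)
    exact (hF' j).comp hz (fun p hp => hIU _ hp.1 _ hp.2)

lemma const_of_deriv_Ioo {f : ℝ → ℝ} {a b : ℝ} (hab : a < b) (hc : ContinuousOn f (Icc a b))
    (hf : ∀ x ∈ Ioo a b, HasDerivAt f 0 x) : f b = f a := by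
  obtain ⟨c, hc, h⟩ := exists_hasDerivAt_eq_slope f (fun _ => 0) hab hc hf
  have : b - a ≠ 0 := by linarith
  field_simp at h
  linarith

lemma c1_facts {d : ℕ} {U : Set (EuclideanSpace ℝ (Fin d))} (hU : IsOpen U)
    {f : EuclideanSpace ℝ (Fin d) → ℝ} (hf : ContDiffOn ℝ 1 f U) :
    (∀ x ∈ U, HasFDerivAt f (fderiv ℝ f x) x) ∧ ContinuousOn (fderiv ℝ f) U :=
  ⟨fun _ hx => ((hf.differentiableOn (by norm_num)).differentiableAt
    (hU.mem_nhds hx)).hasFDerivAt, hf.continuousOn_fderiv_of_isOpen hU (by norm_num)⟩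

theorem mean_value_abs {d : ℕ} (hd : 2 ≤ d) (k : Fin d)
    {μ : Measure (EuclideanSpace ℝ (Fin d))} [IsFiniteMeasure μ] {r : ℝ}
    (hK : ∀ᵐ y ∂μ, y ∈ sphere (0 : EuclideanSpace ℝ (Fin d)) r)
    (hinv : ∀ e : EuclideanSpace ℝ (Fin d) ≃ₗᵢ[ℝ] EuclideanSpace ℝ (Fin d),
      MeasurePreserving e μ μ)
    {U : Set (EuclideanSpace ℝ (Fin d))} (hU : IsOpen U) (z : EuclideanSpace ℝ (Fin d))
    (hzU : closedBall z r ⊆ U) (hUk : ∀ x ∈ U, x k ≠ 0)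
    {s : ℝ} (hs : 1 < s)
    (hIU : ∀ t ∈ Ioo (-s) s, ∀ y ∈ sphere (0 : EuclideanSpace ℝ (Fin d)) r, z + t • y ∈ U)
    (φ : EuclideanSpace ℝ (Fin d) → ℝ) (hφ : ContDiffOn ℝ 2 φ U)
    (hpde : ∀ x ∈ closedBall z r, x k * lap φ x = 2 * pd k φ x) (hr : 0 < r) :
    ∫ y, φ (z + y) ∂μ = μ.real univ * (φ z + r ^ 2 / (d * z k) * pd k φ z) := by
  have hKc := isCompact_sphere (0 : EuclideanSpace ℝ (Fin d)) r
  have hd0 : (d : ℝ) ≠ 0 := by positivity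
  have hzk : z k ≠ 0 := hUk z (hzU (mem_closedBall_self hr.le))
  have hball : ∀ t ∈ Ico (0 : ℝ) 1, ∀ y ∈ sphere (0 : EuclideanSpace ℝ (Fin d)) r,
      z + t • y ∈ closedBall z r := by
    intro t ht y hy
    have hy' : ‖y‖ = r := by simpa using hy
    simp only [mem_closedBall, dist_self_add_left, norm_smul, hy', Real.norm_eq_abs,
      abs_of_nonneg ht.1]
    nlinarith [ht.2]
  have hI01 : ∀ t ∈ Icc (0 : ℝ) 1, t ∈ Ioo (-s) s := fun t ht =>
    ⟨by linarith [ht.1], by linarith [ht.2]⟩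
  have hI : ∀ t ∈ Ico (0 : ℝ) 1, t ∈ Ioo (-s) s := fun t ht => hI01 t ⟨ht.1, ht.2.le⟩
  have hφ1 : ContDiffOn ℝ 1 φ U := hφ.of_le (by norm_num)
  have hpd : ∀ i, ContDiffOn ℝ 1 (pd i φ) U := fun i =>
    (hφ.fderiv_of_isOpen hU (m := 1) (by norm_num)).clm_apply contDiffOn_const
  have hco : ContDiffOn ℝ 1 (fun x : EuclideanSpace ℝ (Fin d) => x k) U :=
    (EuclideanSpace.proj k : EuclideanSpace ℝ (Fin d) →L[ℝ] ℝ).contDiff.contDiffOn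
  let F1 : Fin d → EuclideanSpace ℝ (Fin d) → ℝ := fun i x => pd i φ x / (x k) ^ 2
  let F3 : Fin d → EuclideanSpace ℝ (Fin d) → ℝ := fun i x => pd i φ x / x k
  have hF1 : ∀ i, ContDiffOn ℝ 1 (F1 i) U := fun i =>
    (hpd i).div (hco.pow 2) fun x hx => pow_ne_zero _ (hUk x hx)
  have hF3 : ∀ i, ContDiffOn ℝ 1 (F3 i) U := fun i => (hpd i).div hco hUk
  have hk' : ∀ x, HasFDerivAt (fun x : EuclideanSpace ℝ (Fin d) => x k)
      (EuclideanSpace.proj k : EuclideanSpace ℝ (Fin d) →L[ℝ] ℝ) x := fun x =>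
      (EuclideanSpace.proj k : EuclideanSpace ℝ (Fin d) →L[ℝ] ℝ).hasFDerivAt
  have dF3 : ∀ i, ∀ x ∈ U, ∀ v, fderiv ℝ (F3 i) x v =
      fderiv ℝ (pd i φ) x v / x k - pd i φ x * v k / (x k) ^ 2 := by
    intro i x hx v
    have hF : F3 i = fun x => pd i φ x * (x k)⁻¹ := by
      funext x; simp only [F3, div_eq_mul_inv]
    have := ((c1_facts hU (hpd i)).1 x hx).mul
      ((hasDerivAt_inv (hUk x hx)).comp_hasFDerivAt x (hk' x))
    rw [hF, show fderiv ℝ (fun x => pd i φ x * (x k)⁻¹) x = _ from this.fderiv]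
    have := hUk x hx
    simp
    field_simp
    ring
  have dF1 : ∀ i, ∀ x ∈ U, ∀ v, fderiv ℝ (F1 i) x v =
      fderiv ℝ (pd i φ) x v / (x k) ^ 2 - 2 * pd i φ x * v k / (x k) ^ 3 := by
    intro i x hx v
    have hF : F1 i = fun x => pd i φ x * ((x k) ^ 2)⁻¹ := by
      funext x; simp only [F1, div_eq_mul_inv]
    have := ((c1_facts hU (hpd i)).1 x hx).mul
      (((hasDerivAt_pow 2 (x k)).inv (pow_ne_zero _ (hUk x hx))).comp_hasFDerivAt x (hk' x))
    rw [hF, show fderiv ℝ (fun x => pd i φ x * ((x k) ^ 2)⁻¹) x = _ from this.fderiv]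
    have := hUk x hx
    simp
    field_simp
    ring
  have hsymm : ∀ i j, ∀ x ∈ U, fderiv ℝ (pd i φ) x (EuclideanSpace.single j 1) =
      fderiv ℝ (pd j φ) x (EuclideanSpace.single i 1) := by
    intro i j x hx
    have h1 : IsSymmSndFDerivAt ℝ φ x :=
      (hφ.contDiffAt (hU.mem_nhds hx)).isSymmSndFDerivAt (by simp)
    have h2 : DifferentiableAt ℝ (fderiv ℝ φ) x :=
      ((hφ.fderiv_of_isOpen hU (m := 1) (by norm_num)).differentiableOn
        (by norm_num)).differentiableAt (hU.mem_nhds hx)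
    have h3 : ∀ i v, fderiv ℝ (pd i φ) x v =
        fderiv ℝ (fderiv ℝ φ) x v (EuclideanSpace.single i 1) := by
      intro i v
      have := h2.hasFDerivAt.clm_apply (hasFDerivAt_const (EuclideanSpace.single i (1 : ℝ)) x)
      rw [show fderiv ℝ (pd i φ) x = _ from this.fderiv]
      simp
    rw [h3, h3, h1]
  have hyk : ∀ j : Fin d, Continuous (fun y : EuclideanSpace ℝ (Fin d) => y j) := by
    intro j; fun_prop
  -- step 1: flux vanishes
  have step1 : ∀ t ∈ Ioo (0 : ℝ) 1, ∫ y, ∑ j, y j * F1 j (z + t • y) ∂μ = 0 := by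
    intro t ht
    have := ode_sol hd (fun t => ∫ y, ∑ j, y j * F1 j (z + t • y) ∂μ)
      (fun t => ∫ y, ∑ j, y j * fderiv ℝ (F1 j) (z + t • y) y ∂μ) 0
      (fun t ht => mean_deriv hK z isOpen_Ioo hIU (fun j y => y j) hyk F1 _
        (fun j => (c1_facts hU (hF1 j)).1) (fun j => (c1_facts hU (hF1 j)).2) t (hI t ht))
      (fun t ht => ?_) t ht
    · simpa using this
    rw [div_id hK hinv z F1 _ (fun j => (c1_facts hU (hF1 j)).1)
      (fun j => (c1_facts hU (hF1 j)).2) t (hIU t (hI t ht))]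
    have : ∫ y, ∑ j, fderiv ℝ (F1 j) (z + t • y) (EuclideanSpace.single j 1) ∂μ = 0 := by
      refine integral_eq_zero_of_ae ?_
      filter_upwards [hK] with y hy
      have hyU := hIU t (hI t ht) y hy
      have hne := hUk _ hyU
      have hp := hpde _ (hball t ht y hy)
      have e : ∀ j, fderiv ℝ (F1 j) (z + t • y) (EuclideanSpace.single j 1) =
        pd j (pd j φ) (z + t • y) / ((z + t • y) k) ^ 2 -
          (if k = j then 2 * pd k φ (z + t • y) / ((z + t • y) k) ^ 3 else 0) := by
        intro j
        rw [dF1 j _ hyU]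
        by_cases h : k = j
        · subst h; simp [pd]
        · simp [h, pd]
      simp only [e, Finset.sum_sub_distrib, ← Finset.sum_div]
      rw [← lap]
      simp only [Finset.sum_ite_eq, Finset.mem_univ, if_true, Pi.zero_apply]
      rw [← hp]
      field_simp
      simp
    rw [this]; simp
  -- step 2: the mean of `∂ₖφ / xₖ` is constant
  have hN : ∀ t ∈ Ioo (-s) s, HasDerivAt (fun t => ∫ y, F3 k (z + t • y) ∂μ)
      (∫ y, fderiv ℝ (F3 k) (z + t • y) y ∂μ) t := by
    intro t ht
    have := mean_deriv hK z isOpen_Ioo hIU (ι := Unit) (fun _ _ => 1)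
      (fun _ => continuous_const) (fun _ => F3 k) (fun _ => fderiv ℝ (F3 k))
      (fun _ => (c1_facts hU (hF3 k)).1) (fun _ => (c1_facts hU (hF3 k)).2) t ht
    simpa using this
  have hN0 : ∀ t ∈ Ioo (0 : ℝ) 1, ∫ y, fderiv ℝ (F3 k) (z + t • y) y ∂μ = 0 := by
    intro t ht
    have htI := hI t ⟨ht.1.le, ht.2⟩
    have hz : ContinuousOn (fun y : EuclideanSpace ℝ (Fin d) => z + t • y) (sphere 0 r) := by
      fun_prop
    have c3 : ∀ i, ContinuousOn (fun y => fderiv ℝ (F3 i) (z + t • y)) (sphere 0 r) := fun i =>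
      (c1_facts hU (hF3 i)).2.comp hz (hIU t htI)
    have hrot : ∀ i, ∫ y, (y i * fderiv ℝ (F3 i) (z + t • y) (EuclideanSpace.single k 1)
        - y k * fderiv ℝ (F3 i) (z + t • y) (EuclideanSpace.single i 1)) ∂μ = 0 := by
      intro i
      have := rot_int_coord hK hinv (fun y => F3 i (z + t • y))
        (fun y => t • fderiv ℝ (F3 i) (z + t • y)) ?_ ((c3 i).const_smul t) i k
      · have e : ∀ y : EuclideanSpace ℝ (Fin d),
          (y i * (t • fderiv ℝ (F3 i) (z + t • y)) (EuclideanSpace.single k 1)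
            - y k * (t • fderiv ℝ (F3 i) (z + t • y)) (EuclideanSpace.single i 1)) =
          t * (y i * fderiv ℝ (F3 i) (z + t • y) (EuclideanSpace.single k 1)
            - y k * fderiv ℝ (F3 i) (z + t • y) (EuclideanSpace.single i 1)) := by
          intro y; simp; ring
        simp only [e, integral_const_mul] at this
        exact (mul_eq_zero.1 this).resolve_left ht.1.ne'
      · intro y hy
        have h2 : HasFDerivAt (fun y : EuclideanSpace ℝ (Fin d) => z + t • y)
          (t • ContinuousLinearMap.id ℝ _) y := ((hasFDerivAt_id y).const_smul t).const_add z
        refine (((c1_facts hU (hF3 i)).1 _ (hIU t htI y hy)).comp y h2).congr_fderiv ?_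
        ext v
        simp
    have hri : ∀ i, Integrable
        (fun y => y i * fderiv ℝ (F3 i) (z + t • y) (EuclideanSpace.single k 1)
        - y k * fderiv ℝ (F3 i) (z + t • y) (EuclideanSpace.single i 1)) μ := fun i =>
      int_of_cont hKc hK (((hyk i).continuousOn.mul ((c3 i).clm_apply continuousOn_const)).sub
        ((hyk k).continuousOn.mul ((c3 i).clm_apply continuousOn_const)))
    have hsum : ∫ y, ∑ i, (y i * fderiv ℝ (F3 i) (z + t • y) (EuclideanSpace.single k 1)
        - y k * fderiv ℝ (F3 i) (z + t • y) (EuclideanSpace.single i 1)) ∂μ = 0 := by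
      rw [integral_finsetSum _ fun i _ => hri i]
      exact Finset.sum_eq_zero fun i _ => hrot i
    have hi1 : Integrable (fun y => ∑ j, y j * F1 j (z + t • y)) μ :=
      int_of_cont hKc hK (continuousOn_finsetSum _ fun j _ => (hyk j).continuousOn.mul
        ((hF1 j).continuousOn.comp hz (hIU t htI)))
    have hadd := integral_add (integrable_finsetSum Finset.univ fun i _ => hri i) hi1
    rw [hsum, step1 t ht, add_zero] at hadd
    rw [← hadd]
    refine integral_congr_ae ?_
    filter_upwards [hK] with y hy
    have hyU := hIU t htI y hy
    have hne := hUk _ hyU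
    have hp := hpde _ (hball t ⟨ht.1.le, ht.2⟩ y hy)
    generalize z + t • y = x at *
    rw [dF3 k x hyU, clm_coord (fderiv ℝ (pd k φ) x) y]
    have e : ∀ i, (y i * fderiv ℝ (F3 i) x (EuclideanSpace.single k 1)
        - y k * fderiv ℝ (F3 i) x (EuclideanSpace.single i 1)) =
        y i * fderiv ℝ (pd k φ) x (EuclideanSpace.single i 1) / x k - y i * F1 i x
        - y k * pd i (pd i φ) x / x k + (if k = i then y k * F1 k x else 0) := by
      intro i
      rw [dF3 i x hyU, dF3 i x hyU, hsymm i k x hyU]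
      by_cases h : k = i
      · subst h; simp [F1, pd]
      · simp [h, F1, pd]; ring
    simp only [e, Finset.sum_sub_distrib, Finset.sum_add_distrib, ← Finset.sum_div,
      ← Finset.mul_sum]
    rw [← lap]
    simp only [Finset.sum_ite_eq, Finset.mem_univ, if_true]
    have hl : lap φ x = 2 * pd k φ x / x k := by field_simp; linarith
    rw [hl]
    simp only [F1]
    field_simp
    ring
  have hNc : ∀ t ∈ Ico (0 : ℝ) 1, ∫ y, F3 k (z + t • y) ∂μ = μ.real univ * F3 k z := by
    intro t ht
    have h00 : ∫ y, F3 k (z + (0 : ℝ) • y) ∂μ = μ.real univ * F3 k z := by simp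
    rcases ht.1.eq_or_lt with h | h
    · rw [← h, h00]
    rw [← h00]
    exact const_of_deriv_Ioo (f := fun t => ∫ y, F3 k (z + t • y) ∂μ) h
      (fun u hu => (hN u (hI u ⟨hu.1, hu.2.trans_lt ht.2⟩)).continuousAt.continuousWithinAt)
      (fun u hu => by
        have := hN u (hI u ⟨hu.1.le, hu.2.trans ht.2⟩)
        rwa [hN0 u ⟨hu.1, hu.2.trans ht.2⟩] at this)
  -- step 3
  have step3 : ∀ t ∈ Ioo (0 : ℝ) 1, ∫ y, ∑ j, y j * pd j φ (z + t • y) ∂μ =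
      (2 * r ^ 2 * (μ.real univ * F3 k z)) * t / d := by
    refine ode_sol hd (fun t => ∫ y, ∑ j, y j * pd j φ (z + t • y) ∂μ)
      (fun t => ∫ y, ∑ j, y j * fderiv ℝ (pd j φ) (z + t • y) y ∂μ) _
      (fun t ht => mean_deriv hK z isOpen_Ioo hIU (fun j y => y j) hyk (fun j => pd j φ) _
        (fun j => (c1_facts hU (hpd j)).1) (fun j => (c1_facts hU (hpd j)).2) t (hI t ht))
      (fun t ht => ?_)
    rw [div_id hK hinv z (fun j => pd j φ) _ (fun j => (c1_facts hU (hpd j)).1)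
      (fun j => (c1_facts hU (hpd j)).2) t (hIU t (hI t ht))]
    have : ∫ y, ∑ j, fderiv ℝ (pd j φ) (z + t • y) (EuclideanSpace.single j 1) ∂μ
        = 2 * (μ.real univ * F3 k z) := by
      rw [← hNc t ht, ← integral_const_mul]
      refine integral_congr_ae ?_
      filter_upwards [hK] with y hy
      have hne := hUk _ (hIU t (hI t ht) y hy)
      have hp := hpde _ (hball t ht y hy)
      change lap φ (z + t • y) = _
      simp only [F3]
      field_simp
      linarith
    rw [this]; ring
  have hM : ∀ t ∈ Ioo (-s) s, HasDerivAt (fun t => ∫ y, φ (z + t • y) ∂μ)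
      (∫ y, ∑ j, y j * pd j φ (z + t • y) ∂μ) t := by
    intro t ht
    have := mean_deriv hK z isOpen_Ioo hIU (ι := Unit) (fun _ _ => 1)
      (fun _ => continuous_const) (fun _ => φ) (fun _ => fderiv ℝ φ)
      (fun _ => (c1_facts hU hφ1).1) (fun _ => (c1_facts hU hφ1).2) t ht
    have e : ∀ y, fderiv ℝ φ (z + t • y) y = ∑ j, y j * pd j φ (z + t • y) :=
      fun y => clm_coord _ _
    simpa [e] using this
  have hM' : ∀ t ∈ Icc (0 : ℝ) 1, HasDerivAt (fun t => (∫ y, φ (z + t • y) ∂μ) -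
      r ^ 2 * (μ.real univ * F3 k z) / d * t ^ 2) ((∫ y, ∑ j, y j * pd j φ (z + t • y) ∂μ) -
      r ^ 2 * (μ.real univ * F3 k z) / d * (2 * t)) t := by
    intro t ht
    exact (hM t (hI01 t ht)).sub (((hasDerivAt_pow 2 t).const_mul _).congr_deriv (by simp))
  have hfin := const_of_deriv_Ioo (zero_lt_one' ℝ)
    (fun t ht => (hM' t ht).continuousAt.continuousWithinAt) (fun t ht => by
      refine (hM' t ⟨ht.1.le, ht.2.le⟩).congr_deriv ?_
      rw [step3 t ht]
      ring)
  simp [F3] at hfin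
  rw [sub_eq_iff_eq_add] at hfin
  rw [hfin]
  field_simp

/-- If the sphere had infinite measure, integrals of continuous functions would vanish. -/
lemma int_zero_of_top {d : ℕ} {ν : Measure (EuclideanSpace ℝ (Fin d))} {r : ℝ}
    (hinv : ∀ e : EuclideanSpace ℝ (Fin d) ≃ₗᵢ[ℝ] EuclideanSpace ℝ (Fin d),
      MeasurePreserving e ν ν)
    (htop : ν (sphere 0 r) = ⊤) (f : EuclideanSpace ℝ (Fin d) → ℝ)
    (hf : ContinuousOn f (sphere 0 r)) : ∫ y in sphere 0 r, f y ∂ν = 0 := by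
  by_cases h0 : ∀ y ∈ sphere (0 : EuclideanSpace ℝ (Fin d)) r, f y = 0
  · exact setIntegral_eq_zero_of_forall_eq_zero h0
  push Not at h0
  obtain ⟨x0, hx0, hne⟩ := h0
  refine integral_undef fun hint => ?_
  have hc : 0 < ‖f x0‖ / 2 := by positivity
  have hlt := hint.measure_norm_ge_lt_top hc
  have hnh : {y | ‖f x0‖ / 2 < ‖f y‖} ∈ 𝓝[sphere 0 r] x0 :=
    (hf x0 hx0).norm.eventually (lt_mem_nhds (by linarith : ‖f x0‖ / 2 < ‖f x0‖))
  obtain ⟨O, hO, hxO, hsub⟩ := mem_nhdsWithin.1 hnh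
  have hOlt : ν (O ∩ sphere 0 r) < ⊤ := by
    rw [← Measure.restrict_apply hO.measurableSet]
    refine lt_of_le_of_lt (measure_mono_ae ?_) hlt
    filter_upwards [ae_restrict_mem isClosed_sphere.measurableSet] with y hy hyO
    exact le_of_lt (hsub ⟨hyO, hy⟩)
  have hfin : ν (sphere (0 : EuclideanSpace ℝ (Fin d)) r) < ⊤ := by
    refine (isCompact_sphere _ _).measure_lt_top_of_nhdsWithin fun x hx => ?_
    let R : EuclideanSpace ℝ (Fin d) ≃ₗᵢ[ℝ] EuclideanSpace ℝ (Fin d) :=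
      (Submodule.span ℝ {x - x0})ᗮ.reflection
    have hR : R x = x0 := Submodule.reflection_sub (by
      rw [mem_sphere_zero_iff_norm.1 hx, mem_sphere_zero_iff_norm.1 hx0])
    refine ⟨(R ⁻¹' O) ∩ sphere 0 r, ?_, ?_⟩
    · rw [inter_comm]
      refine inter_mem_nhdsWithin _ ((hO.preimage R.continuous).mem_nhds ?_)
      simpa [hR] using hxO
    · have : (R ⁻¹' O) ∩ sphere 0 r = R ⁻¹' (O ∩ sphere 0 r) := by
        ext y; simp
      rw [this, (hinv R).measure_preimage
        (hO.measurableSet.inter isClosed_sphere.measurableSet).nullMeasurableSet]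
      exact hOlt
  exact absurd htop hfin.ne

/-- Mean value identity (surface version) for solutions of `∇·(ζ₁⁻² ∇φ) = 0`,
i.e. `ζ₁·Δφ = 2·∂₁φ`, on a closed ball avoiding `{ζ₁ = 0}`: the integral of `φ`
over the sphere `∂B(ζ', r)` with respect to the `(d-1)`-dimensional Hausdorff
measure equals `s_{d-1}·(φ(ζ') + (r²/(d·ζ₁'))·∂₁φ(ζ'))`. -/
theorem mean_value_surface (d : ℕ) (hd : 2 ≤ d)
    (ζ' : EuclideanSpace ℝ (Fin d))
    (hζ'1 : ζ' ⟨0, by omega⟩ ≠ 0)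
    (r : ℝ) (hr : 0 < r)
    (hball : Metric.closedBall ζ' r ⊆
      {ζ : EuclideanSpace ℝ (Fin d) | ζ ⟨0, by omega⟩ ≠ 0})
    (φ : EuclideanSpace ℝ (Fin d) → ℝ)
    (V : Set (EuclideanSpace ℝ (Fin d))) (hV : IsOpen V)
    (hVball : Metric.closedBall ζ' r ⊆ V)
    (hφ : ContDiffOn ℝ 2 φ V)
    (hpde : ∀ ζ ∈ Metric.closedBall ζ' r,
      ζ ⟨0, by omega⟩ * lap φ ζ = 2 * pd ⟨0, by omega⟩ φ ζ) :
    ∫ ζ in Metric.sphere ζ' r, φ ζ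
        ∂(Measure.hausdorffMeasure ((d : ℝ) - 1) :
            Measure (EuclideanSpace ℝ (Fin d))) =
      ((Measure.hausdorffMeasure ((d : ℝ) - 1) :
            Measure (EuclideanSpace ℝ (Fin d))) (Metric.sphere ζ' r)).toReal *
        (φ ζ' + r ^ 2 / ((d : ℝ) * ζ' ⟨0, by omega⟩) * pd ⟨0, by omega⟩ φ ζ') := by
  have hiso : ∀ e : EuclideanSpace ℝ (Fin d) ≃ₗᵢ[ℝ] EuclideanSpace ℝ (Fin d),
      MeasurePreserving e (Measure.hausdorffMeasure ((d : ℝ) - 1) :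
            Measure (EuclideanSpace ℝ (Fin d))) (Measure.hausdorffMeasure ((d : ℝ) - 1)) :=
    fun e => e.toIsometryEquiv.measurePreserving_hausdorffMeasure _
  have htr : MeasurePreserving (fun y => ζ' + y) (Measure.hausdorffMeasure ((d : ℝ) - 1) :
            Measure (EuclideanSpace ℝ (Fin d))) (Measure.hausdorffMeasure ((d : ℝ) - 1)) :=
    (IsometryEquiv.addLeft ζ').measurePreserving_hausdorffMeasure _
  have hpre : (fun y => ζ' + y) ⁻¹' sphere ζ' r = sphere 0 r := by
    ext y; simp
  rw [← htr.setIntegral_preimage_emb (Homeomorph.addLeft ζ').measurableEmbedding,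
    ← htr.measure_preimage isClosed_sphere.measurableSet.nullMeasurableSet, hpre]
  generalize (Measure.hausdorffMeasure ((d : ℝ) - 1) :
            Measure (EuclideanSpace ℝ (Fin d))) = ν at hiso
  have hmap : ∀ y ∈ sphere (0 : EuclideanSpace ℝ (Fin d)) r, ζ' + y ∈ closedBall ζ' r := by
    intro y hy
    simpa using (mem_sphere_zero_iff_norm.1 hy).le
  by_cases htop : ν (sphere 0 r) = ⊤
  · rw [htop, int_zero_of_top hiso htop (fun y => φ (ζ' + y))]
    · simp
    · exact hφ.continuousOn.comp (by fun_prop) fun y hy => hVball (hmap y hy)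
  let μ := ν.restrict (sphere 0 r)
  have hfin : IsFiniteMeasure μ := ⟨by
    simpa [μ] using lt_top_iff_ne_top.2 htop⟩
  have hreal : (ν (sphere 0 r)).toReal = μ.real univ := by simp [μ, Measure.real]
  rw [hreal]
  have hKae : ∀ᵐ y ∂μ, y ∈ sphere (0 : EuclideanSpace ℝ (Fin d)) r :=
    ae_restrict_mem isClosed_sphere.measurableSet
  have hinv : ∀ e : EuclideanSpace ℝ (Fin d) ≃ₗᵢ[ℝ] EuclideanSpace ℝ (Fin d),
      MeasurePreserving e μ μ := by
    intro e
    have := (hiso e).restrict_preimage (s := sphere 0 r) isClosed_sphere.measurableSet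
    have he : e ⁻¹' sphere 0 r = sphere 0 r := by ext y; simp
    rwa [he] at this
  have hcoord : Continuous fun x : EuclideanSpace ℝ (Fin d) => x ⟨0, by omega⟩ := by fun_prop
  let U : Set (EuclideanSpace ℝ (Fin d)) := V ∩ {x | x ⟨0, by omega⟩ ≠ 0}
  have hU : IsOpen U := hV.inter (isOpen_ne_fun hcoord continuous_const)
  have hbU : closedBall ζ' r ⊆ U := subset_inter hVball hball
  obtain ⟨δ, hδ, hδU⟩ := (isCompact_closedBall ζ' r).exists_thickening_subset_open hU hbU
  refine mean_value_abs hd ⟨0, by omega⟩ hKae hinv hU ζ' hbU (fun x hx => hx.2)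
    (s := 1 + δ / r) (by have := div_pos hδ hr; linarith) ?_ φ (hφ.mono inter_subset_left) hpde hr
  intro t ht y hy
  apply hδU
  rw [thickening_closedBall hδ hr.le]
  have hy' : ‖y‖ = r := by simpa using hy
  have ht' : |t| < 1 + δ / r := abs_lt.2 ht
  simp only [mem_ball, dist_self_add_left, norm_smul, hy', Real.norm_eq_abs]
  calc |t| * r < (1 + δ / r) * r := by gcongr
    _ = δ + r := by field_simp; ring
end

section
/- Let d ≥ 1, let U ⊆ {ζ ∈ ℝ^d : ζ₁ ≠ 0} be open, and let f : ℝ^d → ℝ be smooth on U. Define H g = Δg − (2/ζ₁²)·g and (𝒯₀ f)(ζ) = ζ₁·f(ζ). Then: (i) the operator 𝒯₁ f := 𝒯₀(Δf) − H(𝒯₀ f) is given explicitly by (𝒯₁ f)(ζ) = −2·( ∂f/∂ζ₁(ζ) − f(ζ)/ζ₁ ); and (ii) 𝒯₂ := 𝒯₁∘Δ − H∘𝒯₁ vanishes identically, i.e. H( ∂f/∂ζ₁ − f/ζ₁ )(ζ) = ∂(Δf)/∂ζ₁(ζ) − (Δf)(ζ)/ζ₁ for all ζ ∈ U. In particular the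 Hadamard recursion 𝒯_{i+1} = 𝒯ᵢ∘Δ − H∘𝒯ᵢ with 𝒯₀ = multiplication by ζ₁ truncates after two steps, giving the intertwining identity H∘𝒯₁ = 𝒯₁∘Δ. -/
section helpers

variable {d : ℕ} {U : Set (EuclideanSpace ℝ (Fin d))}

theorem aux_diff (hU : IsOpen U) {g : EuclideanSpace ℝ (Fin d) → ℝ}
    (hg : ContDiffOn ℝ (⊤ : ℕ∞) g U) {x} (hx : x ∈ U) : DifferentiableAt ℝ g x :=
  (hg.contDiffAt (hU.mem_nhds hx)).differentiableAt (by simp)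

theorem aux_pd_smooth (hU : IsOpen U) (i : Fin d) {g : EuclideanSpace ℝ (Fin d) → ℝ}
    (hg : ContDiffOn ℝ (⊤ : ℕ∞) g U) : ContDiffOn ℝ (⊤ : ℕ∞) (pd i g) U := by
  have h : ContDiffOn ℝ (⊤ : ℕ∞) (fderiv ℝ g) U := hg.fderiv_of_isOpen hU (by simp)
  exact h.clm_apply contDiffOn_const

theorem aux_pd_congr (hU : IsOpen U) (i : Fin d) {g h : EuclideanSpace ℝ (Fin d) → ℝ}
    (hgh : ∀ x ∈ U, g x = h x) : ∀ x ∈ U, pd i g x = pd i h x := by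
  intro x hx
  have : g =ᶠ[nhds x] h := Filter.eventuallyEq_of_mem (hU.mem_nhds hx) hgh
  unfold pd
  rw [this.fderiv_eq]

theorem aux_pd_mul (hU : IsOpen U) (i : Fin d) {g h : EuclideanSpace ℝ (Fin d) → ℝ}
    (hg : ContDiffOn ℝ (⊤ : ℕ∞) g U) (hh : ContDiffOn ℝ (⊤ : ℕ∞) h U) :
    ∀ x ∈ U, pd i (fun y => g y * h y) x = g x * pd i h x + h x * pd i g x := by
  intro x hx
  unfold pd
  rw [fderiv_fun_mul (aux_diff hU hg hx) (aux_diff hU hh hx)]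
  simp

theorem aux_pd_add (hU : IsOpen U) (i : Fin d) {g h : EuclideanSpace ℝ (Fin d) → ℝ}
    (hg : ContDiffOn ℝ (⊤ : ℕ∞) g U) (hh : ContDiffOn ℝ (⊤ : ℕ∞) h U) :
    ∀ x ∈ U, pd i (fun y => g y + h y) x = pd i g x + pd i h x := by
  intro x hx
  unfold pd
  rw [fderiv_fun_add (aux_diff hU hg hx) (aux_diff hU hh hx)]
  simp

theorem aux_pd_sub (hU : IsOpen U) (i : Fin d) {g h : EuclideanSpace ℝ (Fin d) → ℝ}
    (hg : ContDiffOn ℝ (⊤ : ℕ∞) g U) (hh : ContDiffOn ℝ (⊤ : ℕ∞) h U) :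
    ∀ x ∈ U, pd i (fun y => g y - h y) x = pd i g x - pd i h x := by
  intro x hx
  unfold pd
  rw [fderiv_fun_sub (aux_diff hU hg hx) (aux_diff hU hh hx)]
  simp

theorem aux_pd_comm (hU : IsOpen U) (i j : Fin d) {g : EuclideanSpace ℝ (Fin d) → ℝ}
    (hg : ContDiffOn ℝ (⊤ : ℕ∞) g U) :
    ∀ x ∈ U, pd i (pd j g) x = pd j (pd i g) x := by
  intro x hx
  have h : ContDiffOn ℝ (⊤ : ℕ∞) (fderiv ℝ g) U := hg.fderiv_of_isOpen hU (by simp)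
  have hd : DifferentiableAt ℝ (fderiv ℝ g) x :=
    (h.contDiffAt (hU.mem_nhds hx)).differentiableAt (by simp)
  have key : ∀ a b : Fin d, pd a (pd b g) x
      = fderiv ℝ (fderiv ℝ g) x (EuclideanSpace.single a 1) (EuclideanSpace.single b 1) := by
    intro a b
    unfold pd
    rw [fderiv_clm_apply hd (differentiableAt_const _)]
    simp
  rw [key, key]
  have hs : IsSymmSndFDerivAt ℝ g x :=
    (hg.contDiffAt (hU.mem_nhds hx)).isSymmSndFDerivAt (by
      rw [minSmoothness_of_isRCLikeNormedField]
      exact WithTop.coe_le_coe.mpr (le_top : (2 : ℕ∞) ≤ ⊤))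
  exact hs _ _

theorem aux_lap_mul (hU : IsOpen U) {g h : EuclideanSpace ℝ (Fin d) → ℝ}
    (hg : ContDiffOn ℝ (⊤ : ℕ∞) g U) (hh : ContDiffOn ℝ (⊤ : ℕ∞) h U) :
    ∀ x ∈ U, lap (fun y => g y * h y) x
      = g x * lap h x + 2 * ∑ i, pd i g x * pd i h x + h x * lap g x := by
  intro x hx
  unfold lap
  rw [Finset.mul_sum, Finset.mul_sum, Finset.mul_sum, ← Finset.sum_add_distrib,
    ← Finset.sum_add_distrib]
  refine Finset.sum_congr rfl fun i _ => ?_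
  have hg' := aux_pd_smooth hU i hg
  have hh' := aux_pd_smooth hU i hh
  rw [aux_pd_congr hU i (aux_pd_mul hU i hg hh) x hx,
    aux_pd_add hU i (hg.mul hh') (hh.mul hg') x hx,
    aux_pd_mul hU i hg hh' x hx, aux_pd_mul hU i hh hg' x hx]
  ring

theorem aux_lap_sub (hU : IsOpen U) {g h : EuclideanSpace ℝ (Fin d) → ℝ}
    (hg : ContDiffOn ℝ (⊤ : ℕ∞) g U) (hh : ContDiffOn ℝ (⊤ : ℕ∞) h U) :
    ∀ x ∈ U, lap (fun y => g y - h y) x = lap g x - lap h x := by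
  intro x hx
  unfold lap
  rw [← Finset.sum_sub_distrib]
  refine Finset.sum_congr rfl fun i _ => ?_
  rw [aux_pd_congr hU i (aux_pd_sub hU i hg hh) x hx,
    aux_pd_sub hU i (aux_pd_smooth hU i hg) (aux_pd_smooth hU i hh) x hx]

theorem aux_lap_pd (hU : IsOpen U) (j : Fin d) {g : EuclideanSpace ℝ (Fin d) → ℝ}
    (hg : ContDiffOn ℝ (⊤ : ℕ∞) g U) :
    ∀ x ∈ U, lap (pd j g) x = pd j (fun y => lap g y) x := by
  intro x hx
  have h1 : pd j (fun y => lap g y) x = ∑ i, pd j (pd i (pd i g)) x := by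
    unfold lap
    change fderiv ℝ (fun y => ∑ i, pd i (pd i g) y) x (EuclideanSpace.single j 1) = _
    rw [fderiv_fun_sum (fun i _ =>
      aux_diff hU (aux_pd_smooth hU i (aux_pd_smooth hU i hg)) hx)]
    simp [pd]
  rw [h1]
  unfold lap
  refine Finset.sum_congr rfl fun i _ => ?_
  rw [aux_pd_congr hU i (aux_pd_comm hU i j hg) x hx,
    aux_pd_comm hU i j (aux_pd_smooth hU i hg) x hx]

theorem aux_hasF (j : Fin d) (x : EuclideanSpace ℝ (Fin d)) :
    HasFDerivAt (fun y : EuclideanSpace ℝ (Fin d) => y j)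
      (EuclideanSpace.proj j : EuclideanSpace ℝ (Fin d) →L[ℝ] ℝ) x :=
  (EuclideanSpace.proj j : EuclideanSpace ℝ (Fin d) →L[ℝ] ℝ).hasFDerivAt

theorem aux_pd_coord (i j : Fin d) (x : EuclideanSpace ℝ (Fin d)) :
    pd i (fun y => y j) x = if i = j then 1 else 0 := by
  unfold pd
  rw [(aux_hasF j x).fderiv]
  simp [Pi.single_apply, eq_comm]

theorem aux_pd_const (i : Fin d) (c : ℝ) (x : EuclideanSpace ℝ (Fin d)) :
    pd i (fun _ => c) x = 0 := by
  simp [pd]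

theorem aux_coord_smooth (j : Fin d) :
    ContDiffOn ℝ (⊤ : ℕ∞) (fun y : EuclideanSpace ℝ (Fin d) => y j) U :=
  (EuclideanSpace.proj j : EuclideanSpace ℝ (Fin d) →L[ℝ] ℝ).contDiff.contDiffOn

theorem aux_lap_coord (j : Fin d) (x : EuclideanSpace ℝ (Fin d)) :
    lap (fun y => y j) x = 0 := by
  unfold lap
  refine Finset.sum_eq_zero fun i _ => ?_
  rw [funext (aux_pd_coord i j)]
  exact aux_pd_const i _ x

theorem aux_pd_inv (i j : Fin d) (x : EuclideanSpace ℝ (Fin d)) (hx : x j ≠ 0) :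
    pd i (fun y => (y j)⁻¹) x = if i = j then -((x j)⁻¹ * (x j)⁻¹) else 0 := by
  have h := (hasDerivAt_inv hx).comp_hasFDerivAt x (aux_hasF j x)
  have h2 : fderiv ℝ (fun y : EuclideanSpace ℝ (Fin d) => (y j)⁻¹) x = _ := h.fderiv
  unfold pd
  rw [h2]
  by_cases hij : i = j
  · subst hij
    simp [pow_two]
  · simp [hij, Ne.symm hij]

theorem aux_lap_inv (hU : IsOpen U) (j : Fin d) (h0 : ∀ x ∈ U, x j ≠ 0) :
    ∀ x ∈ U, lap (fun y => (y j)⁻¹) x = 2 * (x j)⁻¹ ^ 3 := by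
  intro x hx
  have hs : ContDiffOn ℝ (⊤ : ℕ∞) (fun y : EuclideanSpace ℝ (Fin d) => (y j)⁻¹) U :=
    (aux_coord_smooth j).inv h0
  unfold lap
  rw [Finset.sum_eq_single j]
  · have e : ∀ y ∈ U, pd j (fun y => (y j)⁻¹) y = 0 - (y j)⁻¹ * (y j)⁻¹ := by
      intro y hy
      rw [aux_pd_inv j j y (h0 y hy)]
      simp
    rw [aux_pd_congr hU j e x hx, aux_pd_sub hU j contDiffOn_const (hs.mul hs) x hx,
      aux_pd_mul hU j hs hs x hx, aux_pd_const, aux_pd_inv j j x (h0 x hx)]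
    simp only [if_true]
    ring
  · intro i _ hij
    have e : ∀ y ∈ U, pd i (fun y => (y j)⁻¹) y = 0 := by
      intro y hy
      rw [aux_pd_inv i j y (h0 y hy)]
      simp [hij]
    rw [aux_pd_congr hU i e x hx, aux_pd_const]
  · simp

end helpers

/-- Hadamard recursion for the Schrödinger operator `H = Δ − 2/ζ₁²` with
tau-function `τ = ζ₁`, `𝒯₀ = multiplication by ζ₁`:
(i) `𝒯₁ f = 𝒯₀(Δf) − H(𝒯₀ f) = −2(∂₁ f − f/ζ₁)`;
(ii) `𝒯₂ f = 𝒯₁(Δf) − H(𝒯₁ f) = 0`, i.e.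
`H(∂₁f − f/ζ₁) = ∂₁(Δf) − (Δf)/ζ₁`; the recursion truncates after two steps,
giving the intertwining identity `H ∘ 𝒯₁ = 𝒯₁ ∘ Δ`. -/
theorem hadamard_recursion_truncates (d : ℕ) (hd : 1 ≤ d)
    (U : Set (EuclideanSpace ℝ (Fin d))) (hU : IsOpen U)
    (hU0 : ∀ ζ ∈ U, ζ (⟨0, hd⟩ : Fin d) ≠ 0)
    (f : EuclideanSpace ℝ (Fin d) → ℝ) (hf : ContDiffOn ℝ (⊤ : ℕ∞) f U) :
    (∀ ζ ∈ U,
      ζ (⟨0, hd⟩ : Fin d) * lap f ζ -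
          (lap (fun η => η (⟨0, hd⟩ : Fin d) * f η) ζ -
            2 / (ζ (⟨0, hd⟩ : Fin d)) ^ 2 * (ζ (⟨0, hd⟩ : Fin d) * f ζ)) =
        -2 * (pd (⟨0, hd⟩ : Fin d) f ζ - f ζ / ζ (⟨0, hd⟩ : Fin d))) ∧
    (∀ ζ ∈ U,
      lap (fun η => pd (⟨0, hd⟩ : Fin d) f η - f η / η (⟨0, hd⟩ : Fin d)) ζ -
          2 / (ζ (⟨0, hd⟩ : Fin d)) ^ 2 *
            (pd (⟨0, hd⟩ : Fin d) f ζ - f ζ / ζ (⟨0, hd⟩ : Fin d)) =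
        pd (⟨0, hd⟩ : Fin d) (fun η => lap f η) ζ -
          lap f ζ / ζ (⟨0, hd⟩ : Fin d)) := by
  generalize (⟨0, hd⟩ : Fin d) = j at *
  refine ⟨fun x hx => ?_, fun x hx => ?_⟩
  · have hx0 := hU0 x hx
    rw [aux_lap_mul hU (aux_coord_smooth j) hf x hx, aux_lap_coord]
    simp only [aux_pd_coord, ite_mul, one_mul, zero_mul, Finset.sum_ite_eq', Finset.mem_univ,
      if_true]
    field_simp
    ring
  · have hx0 := hU0 x hx
    have hs : ContDiffOn ℝ (⊤ : ℕ∞) (fun y : EuclideanSpace ℝ (Fin d) => (y j)⁻¹) U :=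
      (aux_coord_smooth j).inv hU0
    simp only [div_eq_mul_inv]
    rw [aux_lap_sub hU (aux_pd_smooth hU j hf) (hf.mul hs) x hx, aux_lap_pd hU j hf x hx,
      aux_lap_mul hU hf hs x hx, aux_lap_inv hU j hU0 x hx]
    simp only [aux_pd_inv _ j x hx0, mul_ite, mul_zero, Finset.sum_ite_eq', Finset.mem_univ,
      if_true]
    field_simp
    ring
end
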